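/- arXiv:2408.13475 — 7 statements merged into one kernel-verified Lean document; each statement's English description precedes it below -/
import Mathlib

section
/- Let t be a positive integer, Λ a finite set, m : Λ → ℕ with m(λ) ≥ 1 for every λ, Ξ := {(λ,α) : λ ∈ Λ, α ∈ {1,…,m(λ)}}, 𝒱 a linear subspace of ℝ^Λ, Δ : ℝ^Ξ → ℝ^Λ the linear map with Δ(w)(λ) := ∑_{α=1}^{m(λ)} w(λ,α), and 𝒲 := Δ^{-1}(𝒱). Then the following three statements are equivalent: (i) there exists x ∈ ℤ^Λ with x ≠ 0, ∑_{λ∈Λ} m(λ)·|x(λ)| ≤ 2t, ∑_{λ∈Λ} m(λ)·x(λ) = 0, and ∑_{λ∈Λ} v(λ)·x(λ) = 0 for every v ∈ 𝒱; (ii) there exist y, y′ ∈ (ℤ_{≥0})^Λ with y ≠ y′, ∑_{λ∈Λ} m(λ)·y(λ) = ∑_{λ∈Λ} m(λ)·y′(λ) ≤ t, and ∑_{λ∈Λ} v(λ)·y(λ) = ∑_{λ∈Λ} v(λ)·y′(λ) for every v ∈ 𝒱; (iii) there exist z, z′ ∈ (ℤ_{≥0})^Ξ with z ≠ z′, ∑_{(λ,α)∈Ξ}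 z(λ,α) = ∑_{(λ,α)∈Ξ} z′(λ,α) ≤ t, and ∑_{(λ,α)∈Ξ} w(λ,α)·z(λ,α) = ∑_{(λ,α)∈Ξ} w(λ,α)·z′(λ,α) for every w ∈ 𝒲. -/
/-- Lemma (trivial_solution): equivalence of the three formulations of the existence
of a nontrivial integer solution. -/
theorem trivial_solution {Λ : Type*} [Fintype Λ] (t : ℕ) (ht : 0 < t)
    (m : Λ → ℕ) (hm : ∀ l, 1 ≤ m l) (V : Submodule ℝ (Λ → ℝ)) :
    List.TFAE
      [(∃ x : Λ → ℤ, x ≠ 0 ∧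
          ∑ l, (m l : ℤ) * |x l| ≤ 2 * (t : ℤ) ∧
          ∑ l, (m l : ℤ) * x l = 0 ∧
          ∀ v ∈ V, ∑ l, v l * (x l : ℝ) = 0),
       (∃ y y' : Λ → ℕ, y ≠ y' ∧
          ∑ l, m l * y l = ∑ l, m l * y' l ∧
          ∑ l, m l * y l ≤ t ∧
          ∀ v ∈ V, ∑ l, v l * (y l : ℝ) = ∑ l, v l * (y' l : ℝ)),
       (∃ z z' : (Σ l : Λ, Fin (m l)) → ℕ, z ≠ z' ∧
          ∑ ξ, z ξ = ∑ ξ, z' ξ ∧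
          ∑ ξ, z ξ ≤ t ∧
          ∀ w : (Σ l : Λ, Fin (m l)) → ℝ,
            (fun l => ∑ α : Fin (m l), w ⟨l, α⟩) ∈ V →
            ∑ ξ, w ξ * (z ξ : ℝ) = ∑ ξ, w ξ * (z' ξ : ℝ))] := by
  classical
  tfae_have 1 → 2 := by
    rintro ⟨x, hx, h1, h2, h3⟩
    have e1 : ∀ l, (((x l).toNat : ℕ) : ℤ) - (((-x l).toNat : ℕ) : ℤ) = x l := by
      intro l; omega
    have e2 : ∀ l, (((x l).toNat : ℕ) : ℤ) + (((-x l).toNat : ℕ) : ℤ) = |x l| := by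
      intro l
      rcases abs_cases (x l) with h | h <;> omega
    have s1 : ∑ l, (m l : ℤ) * ((x l).toNat : ℤ) - ∑ l, (m l : ℤ) * ((-x l).toNat : ℤ) = 0 := by
      rw [← Finset.sum_sub_distrib, ← h2]
      refine Finset.sum_congr rfl fun l _ => ?_
      rw [← mul_sub, e1]
    have s2 : ∑ l, (m l : ℤ) * ((x l).toNat : ℤ) + ∑ l, (m l : ℤ) * ((-x l).toNat : ℤ)
        ≤ 2 * t := by
      rw [← Finset.sum_add_distrib]
      refine le_trans (le_of_eq ?_) h1
      refine Finset.sum_congr rfl fun l _ => ?_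
      rw [← mul_add, e2]
    refine ⟨fun l => (x l).toNat, fun l => (-x l).toNat, ?_, ?_, ?_, ?_⟩
    · intro h
      apply hx
      funext l
      have h' : (x l).toNat = (-x l).toNat := congrFun h l
      have := e1 l
      simp only [Pi.zero_apply]
      omega
    · zify
      push_cast at s1 ⊢
      linarith
    · zify
      push_cast at s1 s2 ⊢
      linarith
    · intro v hv
      rw [← sub_eq_zero, ← Finset.sum_sub_distrib, ← h3 v hv]
      refine Finset.sum_congr rfl fun l _ => ?_
      rw [← mul_sub]
      congr 1
      exact_mod_cast e1 l
  tfae_have 2 → 3 := by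
    rintro ⟨y, y', hne, h1, h2, h3⟩
    have key : ∀ u : Λ → ℕ, ∑ ξ : (Σ l : Λ, Fin (m l)), u ξ.1 = ∑ l, m l * u l := by
      intro u
      rw [Fintype.sum_sigma]
      simp
    refine ⟨fun ξ => y ξ.1, fun ξ => y' ξ.1, ?_, ?_, ?_, ?_⟩
    · intro h
      apply hne
      funext l
      exact congrFun h ⟨l, ⟨0, hm l⟩⟩
    · rw [key, key, h1]
    · rw [key]; exact h2
    · intro w hw
      have := h3 _ hw
      simpa [Fintype.sum_sigma, Finset.sum_mul] using this
  tfae_have 3 → 1 := by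
    rintro ⟨z, z', hne, h1, h2, h3⟩
    have h3' : ∀ w : (Σ l : Λ, Fin (m l)) → ℝ,
        (fun l => ∑ α : Fin (m l), w ⟨l, α⟩) ∈ V →
        ∑ ξ, w ξ * ((z ξ : ℝ) - z' ξ) = 0 := by
      intro w hw
      simp only [mul_sub, Finset.sum_sub_distrib, h3 w hw, sub_self]
    have hs : ∀ (ξ : Σ l : Λ, Fin (m l)) (l' : Λ),
        ∑ α' : Fin (m l'), (if (⟨l', α'⟩ : Σ l : Λ, Fin (m l)) = ξ then (1 : ℝ) else 0)
          = if l' = ξ.1 then 1 else 0 := by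
      rintro ⟨l, α⟩ l'
      by_cases h : l' = l
      · subst h
        simp
      · simp [h]
    have hc : ∀ l (α β : Fin (m l)),
        (z ⟨l, α⟩ : ℤ) - z' ⟨l, α⟩ = (z ⟨l, β⟩ : ℤ) - z' ⟨l, β⟩ := by
      intro l α β
      have := h3' (fun ξ => (if ξ = ⟨l, α⟩ then 1 else 0) - (if ξ = ⟨l, β⟩ then 1 else 0)) (by
        simp only [Finset.sum_sub_distrib, hs, sub_self]
        exact V.zero_mem)
      simp only [sub_mul, Finset.sum_sub_distrib, ite_mul, one_mul, zero_mul,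
        Finset.sum_ite_eq', Finset.mem_univ, if_true] at this
      have h := sub_eq_zero.mp this
      exact_mod_cast h
    obtain ⟨x, hx⟩ : ∃ x : Λ → ℤ, ∀ l (α : Fin (m l)), (z ⟨l, α⟩ : ℤ) - z' ⟨l, α⟩ = x l :=
      ⟨fun l => (z ⟨l, ⟨0, hm l⟩⟩ : ℤ) - z' ⟨l, ⟨0, hm l⟩⟩, fun l α => hc l α _⟩
    have key : ∀ u : Λ → ℤ, ∑ l, (m l : ℤ) * u l = ∑ ξ : (Σ l : Λ, Fin (m l)), u ξ.1 := by
      intro u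
      rw [Fintype.sum_sigma]
      simp
    have h1z : ∑ ξ, (z ξ : ℤ) = ∑ ξ, (z' ξ : ℤ) := by exact_mod_cast h1
    have h2z : ∑ ξ, (z ξ : ℤ) ≤ t := by exact_mod_cast h2
    refine ⟨x, ?_, ?_, ?_, ?_⟩
    · rintro rfl
      apply hne
      funext ⟨l, α⟩
      have := hx l α
      simp only [Pi.zero_apply] at this
      omega
    · rw [key (fun l => |x l|)]
      have : ∑ ξ : (Σ l : Λ, Fin (m l)), |x ξ.1| ≤ ∑ ξ, ((z ξ : ℤ) + z' ξ) := by
        refine Finset.sum_le_sum ?_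
        rintro ⟨l, α⟩ _
        have := hx l α
        rw [abs_le]
        constructor <;> simp only <;> omega
      rw [Finset.sum_add_distrib] at this
      linarith
    · rw [key]
      have : ∑ ξ : (Σ l : Λ, Fin (m l)), x ξ.1 = ∑ ξ, ((z ξ : ℤ) - z' ξ) :=
        Finset.sum_congr rfl fun ξ _ => (hx ξ.1 ξ.2).symm
      rw [this, Finset.sum_sub_distrib, h1z, sub_self]
    · intro v hv
      have hm0 : ∀ l, (m l : ℝ) ≠ 0 := fun l => by
        have := hm l
        positivity
      have hw := h3' (fun ξ => v ξ.1 / m ξ.1) (by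
        convert hv using 1
        funext l
        have := hm0 l
        simp
        field_simp)
      rw [← hw, Fintype.sum_sigma]
      refine Finset.sum_congr rfl fun l _ => ?_
      have hx' : ∀ α : Fin (m l), (z ⟨l, α⟩ : ℝ) - z' ⟨l, α⟩ = x l := fun α => by
        exact_mod_cast hx l α
      have := hm0 l
      simp only [hx', Finset.sum_const, Finset.card_univ, Fintype.card_fin, nsmul_eq_mul]
      field_simp
  tfae_finish
end

section
/- Let n and k be integers with 2 ≤ k ≤ n−1, and let t be a positive integer with t ≥ b(n,k). Then the U(1) system with parameters (n,k,t) has a nontrivial integer solution. Explicitly, the vector y with y_λ := ((−1)^λ/(n−k−1)!)·∏_{α=1}^{n−k−1}(λ − ⌈k/2⌉ − α) for λ = 0,…,n is such a solution. -/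
/-- The quantity `b(n,k) = (2^⌊k/2⌋/⌈k/2⌉!)·∏_{α=1}^{⌈k/2⌉}(n−k+2α−1)`. -/
def u1B (n k : ℕ) : ℚ :=
  (2 ^ (k / 2) / (Nat.factorial ((k + 1) / 2) : ℚ)) *
    ∏ α ∈ Finset.Icc 1 ((k + 1) / 2), ((n : ℚ) - (k : ℚ) + 2 * (α : ℚ) - 1)

/-- The U(1) system with parameters `(n,k,t)` on an integer vector `x = (x_0,…,x_n)`. -/
def U1System (n k t : ℕ) (x : ℕ → ℤ) : Prop :=
  (∑ l ∈ Finset.range (n + 1), (n.choose l : ℤ) * |x l| ≤ 2 * (t : ℤ)) ∧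
  ∀ j ∈ Finset.range (k + 1),
    ∑ l ∈ Finset.Icc j (n - k + j), ((n - k).choose (l - j) : ℤ) * x l = 0

/-- A vector `x = (x_0,…,x_n)` is nontrivial if some coordinate is nonzero. -/
def U1Nontrivial (n : ℕ) (x : ℕ → ℤ) : Prop :=
  ∃ l ∈ Finset.range (n + 1), x l ≠ 0

/-- Coefficient of `z^c` in `(1+z)^N/(1-z)^m`. -/
noncomputable def u1G (N m c : ℕ) : ℚ :=
  PowerSeries.coeff c ((1 + PowerSeries.X : PowerSeries ℚ) ^ N *
    (PowerSeries.invOneSubPow ℚ m).val)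

/-- Closed form. -/
def u1R (m c : ℕ) : ℚ :=
  (2 ^ c / (Nat.factorial c : ℚ)) * ∏ α ∈ Finset.Icc 1 c, ((m : ℚ) + 2 * (α : ℚ) - 1)

theorem coeff_one_add_X_pow_ps (N l : ℕ) :
    PowerSeries.coeff l ((1 + PowerSeries.X : PowerSeries ℚ) ^ N) = (N.choose l : ℚ) := by
  have h : ((1 + PowerSeries.X : PowerSeries ℚ) ^ N)
      = (((1 + Polynomial.X : Polynomial ℚ) ^ N : Polynomial ℚ) : PowerSeries ℚ) := by
    simp
  rw [h, Polynomial.coeff_coe, Polynomial.coeff_one_add_X_pow]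

theorem u1G_eq_sum (N d c : ℕ) :
    u1G N (d + 1) c =
      ∑ l ∈ Finset.range (c + 1), (N.choose l : ℚ) * ((c - l + d).choose d : ℚ) := by
  unfold u1G
  rw [PowerSeries.coeff_mul, Finset.Nat.sum_antidiagonal_eq_sum_range_succ_mk]
  refine Finset.sum_congr rfl fun l _ => ?_
  rw [coeff_one_add_X_pow_ps, PowerSeries.invOneSubPow_val_succ_eq_mk_add_choose,
    PowerSeries.coeff_mk, add_comm d]

theorem u1G_zero (N m : ℕ) : u1G N m 0 = 1 := by
  cases m with
  | zero => simp [u1G, PowerSeries.invOneSubPow_zero]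
  | succ d => rw [u1G_eq_sum]; simp

theorem u1G_base0 (c : ℕ) : u1G (2 * c) 0 c = (Nat.centralBinom c : ℚ) := by
  rw [u1G, PowerSeries.invOneSubPow_zero, Units.val_one, mul_one, coeff_one_add_X_pow_ps,
    Nat.centralBinom]

theorem u1G_base1 (c : ℕ) : u1G (1 + 2 * c) 1 c = 4 ^ c := by
  rw [show (1 : ℕ) = 0 + 1 from rfl, u1G_eq_sum]
  have := Nat.sum_range_choose_halfway c
  simp only [Nat.choose_zero_right, Nat.cast_one, mul_one]
  rw [zero_add, add_comm 1]
  exact_mod_cast this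

theorem u1G_rec (m c : ℕ) :
    u1G (m + 2 + 2 * (c + 1)) (m + 2) (c + 1) =
      u1G (m + 2 * (c + 1)) m (c + 1) + 4 * u1G (m + 2 + 2 * c) (m + 2) c := by
  unfold u1G
  rw [← PowerSeries.one_sub_pow_mul_invOneSubPow_val_add_eq_invOneSubPow_val ℚ m 2]
  have h4 : (4 : ℚ) * PowerSeries.coeff c ((1 + PowerSeries.X : PowerSeries ℚ) ^ (m + 2 + 2 * c)
        * (PowerSeries.invOneSubPow ℚ (m + 2)).val)
      = PowerSeries.coeff (c + 1) (PowerSeries.X * (PowerSeries.C (4 : ℚ) *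
        ((1 + PowerSeries.X : PowerSeries ℚ) ^ (m + 2 + 2 * c)
        * (PowerSeries.invOneSubPow ℚ (m + 2)).val))) := by
    rw [PowerSeries.coeff_succ_X_mul, PowerSeries.coeff_C_mul]
  rw [h4, ← map_add]
  congr 1
  have : (PowerSeries.C (4 : ℚ)) = 4 := map_ofNat _ 4
  rw [this]
  ring

theorem u1R_zero (m : ℕ) : u1R m 0 = 1 := by simp [u1R]

theorem u1R_succ (m c : ℕ) :
    u1R m (c + 1) = u1R m c * (2 * (m + 2 * c + 1) / (c + 1)) := by
  unfold u1R
  rw [Finset.prod_Icc_succ_top (by omega), Nat.factorial_succ]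
  push_cast
  field_simp
  ring

theorem u1R_base0 (c : ℕ) : u1R 0 c = (Nat.centralBinom c : ℚ) := by
  induction c with
  | zero => simp [u1R]
  | succ c ih =>
    rw [u1R_succ, ih]
    have h := Nat.succ_mul_centralBinom_succ c
    have h' : ((c : ℚ) + 1) * (Nat.centralBinom (c + 1) : ℚ)
      = 2 * (2 * c + 1) * Nat.centralBinom c := by exact_mod_cast h
    field_simp
    push_cast
    linarith

theorem u1R_base1 (c : ℕ) : u1R 1 c = 4 ^ c := by
  induction c with
  | zero => simp [u1R]
  | succ c ih =>
    rw [u1R_succ, ih]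
    field_simp
    push_cast
    ring

theorem u1R_shift (m c : ℕ) :
    u1R (m + 2) c * (m + 1) = u1R m c * (m + 2 * c + 1) := by
  induction c with
  | zero => simp [u1R]
  | succ c ih =>
    rw [u1R_succ, u1R_succ]
    have : u1R (m + 2) c * (2 * (((m + 2 : ℕ) : ℚ) + 2 * c + 1) / (c + 1)) * (m + 1)
      = (u1R (m + 2) c * (m + 1)) * (2 * (((m + 2 : ℕ) : ℚ) + 2 * c + 1) / (c + 1)) := by ring
    rw [this, ih]
    push_cast
    ring

theorem u1R_rec (m c : ℕ) :
    u1R (m + 2) (c + 1) = u1R m (c + 1) + 4 * u1R (m + 2) c := by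
  have h := u1R_shift m c
  have hm : (m : ℚ) + 1 ≠ 0 := by positivity
  have e : u1R (m + 2) c = u1R m c * (m + 2 * c + 1) / (m + 1) := by
    rw [eq_div_iff hm]; exact h
  rw [u1R_succ, u1R_succ, e]
  push_cast
  field_simp
  ring

theorem u1G_eq_u1R (c : ℕ) : ∀ m : ℕ, u1G (m + 2 * c) m c = u1R m c := by
  induction c with
  | zero => intro m; rw [u1G_zero, u1R_zero]
  | succ c ih =>
    intro m
    induction m using Nat.twoStepInduction with
    | zero => rw [zero_add, u1G_base0, u1R_base0]
    | one => rw [u1G_base1, u1R_base1]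
    | more m h1 _ => rw [u1G_rec, u1R_rec, h1, ih]

theorem u1G_pascal (N m c : ℕ) :
    u1G (N + 1) m (c + 1) = u1G N m (c + 1) + u1G N m c := by
  unfold u1G
  rw [← PowerSeries.coeff_succ_X_mul c, ← map_add]
  congr 1
  ring

/-- The explicit solution. -/
def u1Y (c d l : ℕ) : ℤ :=
  if l ≤ c then (-1) ^ (l + d) * ((c - l + d).choose d : ℤ)
  else (-1) ^ l * ((l - c - 1).choose d : ℤ)

theorem u1_prod_low (a d : ℕ) :
    ∏ α ∈ Finset.Icc 1 d, (-(a : ℚ) - (α : ℚ)) =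
      (-1) ^ d * (Nat.factorial d : ℚ) * ((a + d).choose d : ℚ) := by
  induction d with
  | zero => simp
  | succ d ih =>
    rw [Finset.prod_Icc_succ_top (by omega), ih]
    have h := Nat.add_one_mul_choose_eq (a + d) d
    have h' : ((a : ℚ) + d + 1) * ((a + d).choose d : ℚ)
        = ((a + (d + 1)).choose (d + 1) : ℚ) * (d + 1) := by exact_mod_cast h
    rw [Nat.factorial_succ]
    push_cast
    linear_combination (-1) * (-1) ^ d * (Nat.factorial d : ℚ) * h'

theorem u1_prod_high (a d : ℕ) :
    ∏ α ∈ Finset.Icc 1 d, ((a : ℚ) + 1 - (α : ℚ)) =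
      (Nat.factorial d : ℚ) * (a.choose d : ℚ) := by
  induction d with
  | zero => simp
  | succ d ih =>
    rw [Finset.prod_Icc_succ_top (by omega), ih]
    have h' : (a.choose (d + 1) : ℚ) * (d + 1) = (a.choose d : ℚ) * (a - d) := by
      rcases le_or_gt d a with hd | hd
      · have h := Nat.choose_succ_right_eq a d
        have h2 : (a.choose (d + 1) : ℚ) * (d + 1) = (a.choose d : ℚ) * ((a - d : ℕ) : ℚ) := by
          exact_mod_cast h
        rw [h2, Nat.cast_sub hd]
      · rw [Nat.choose_eq_zero_of_lt hd, Nat.choose_eq_zero_of_lt (by omega)]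
        simp
    rw [Nat.factorial_succ]
    push_cast
    linear_combination (-1) * (Nat.factorial d : ℚ) * h'

theorem u1Y_formula (c d l : ℕ) : (u1Y c d l : ℚ) =
    (-1) ^ l / (Nat.factorial d : ℚ) *
      ∏ α ∈ Finset.Icc 1 d, ((l : ℚ) - (c : ℚ) - (α : ℚ)) := by
  have hf : (Nat.factorial d : ℚ) ≠ 0 := by exact_mod_cast Nat.factorial_ne_zero d
  unfold u1Y
  split_ifs with h
  · have e : (l : ℚ) - (c : ℚ) = -((c - l : ℕ) : ℚ) := by
      rw [Nat.cast_sub h]; ring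
    rw [e, u1_prod_low]
    push_cast
    field_simp
    ring
  · have e : (l : ℚ) - (c : ℚ) = ((l - c - 1 : ℕ) : ℚ) + 1 := by
      have : l = (l - c - 1) + c + 1 := by omega
      have h2 : (l : ℚ) = ((l - c - 1 : ℕ) : ℚ) + c + 1 := by exact_mod_cast this
      linarith
    rw [e, u1_prod_high]
    push_cast
    field_simp

theorem u1Y_diff (c d j : ℕ) :
    ∑ l ∈ Finset.Icc j (d + 1 + j), ((d + 1).choose (l - j) : ℤ) * u1Y c d l = 0 := by
  have hi : Finset.Icc j (d + 1 + j) = Finset.Ico (0 + j) (d + 2 + j) := by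
    ext x; simp only [Finset.mem_Icc, Finset.mem_Ico]; omega
  rw [hi, ← Finset.sum_Ico_add', ← Finset.range_eq_Ico]
  let P : Polynomial ℚ := Polynomial.C (1 / (Nat.factorial d : ℚ)) *
    ∏ α ∈ Finset.Icc 1 d, (Polynomial.X - Polynomial.C ((c : ℚ) + (α : ℚ)))
  have hP : P.natDegree < d + 1 := by
    refine Nat.lt_succ_of_le ((Polynomial.natDegree_C_mul_le _ _).trans ?_)
    rw [Polynomial.natDegree_finsetProd_X_sub_C_eq_card]
    simp
  have h0 := congrFun (Polynomial.fwdDiff_iter_eq_zero_of_degree_lt hP) (j : ℚ)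
  rw [fwdDiff_iter_eq_sum_shift] at h0
  have key : ((∑ x ∈ Finset.range (d + 2), ((d + 1).choose (x + j - j) : ℤ) * u1Y c d (x + j) : ℤ) : ℚ)
      = (-1) ^ (d + 1 + j) * ∑ x ∈ Finset.range (d + 1 + 1),
        ((-1 : ℤ) ^ (d + 1 - x) * (d + 1).choose x) • P.eval ((j : ℚ) + x • 1) := by
    rw [Finset.mul_sum]
    push_cast
    refine Finset.sum_congr rfl fun x hx => ?_
    have hx' : x ≤ d + 1 := by have := Finset.mem_range.1 hx; omega
    rw [u1Y_formula]
    simp only [P, Polynomial.eval_mul, Polynomial.eval_C, Polynomial.eval_prod,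
      Polynomial.eval_sub, Polynomial.eval_X, Nat.add_sub_cancel, zsmul_eq_mul, nsmul_eq_mul]
    have hs : ((-1 : ℚ)) ^ (x + j) = (-1) ^ (d + 1 + j) * (-1) ^ (d + 1 - x) := by
      rw [← pow_add]
      have : d + 1 + j + (d + 1 - x) = (x + j) + 2 * (d + 1 - x) := by omega
      rw [this, pow_add _ (x + j), pow_mul]
      simp
    have hp : ∏ α ∈ Finset.Icc 1 d, (((x + j : ℕ) : ℚ) - c - α)
        = ∏ α ∈ Finset.Icc 1 d, ((j : ℚ) + x * 1 - (c + α)) := by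
      refine Finset.prod_congr rfl fun α _ => ?_
      push_cast; ring
    rw [hp, hs]
    push_cast
    ring
  rw [h0] at key
  have : ((∑ x ∈ Finset.range (d + 2), ((d + 1).choose (x + j - j) : ℤ) * u1Y c d (x + j) : ℤ) : ℚ) = 0 := by
    rw [key]; simp
  exact_mod_cast this

theorem u1Y_abs (c d l : ℕ) : |u1Y c d l| =
    if l ≤ c then ((c - l + d).choose d : ℤ) else ((l - c - 1).choose d : ℤ) := by
  unfold u1Y
  split_ifs <;> simp [abs_mul]

theorem u1Y_sum (c f d n : ℕ) (hn : n = d + 1 + c + f) :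
    ((∑ l ∈ Finset.range (n + 1), (n.choose l : ℤ) * |u1Y c d l| : ℤ) : ℚ) =
      u1G n (d + 1) c + u1G n (d + 1) f := by
  rw [show n + 1 = (c + 1) + d + (f + 1) by omega, Finset.sum_range_add, Finset.sum_range_add,
    u1G_eq_sum, u1G_eq_sum]
  have hmid : ∑ x ∈ Finset.range d, (n.choose (c + 1 + x) : ℤ) * |u1Y c d (c + 1 + x)| = 0 := by
    refine Finset.sum_eq_zero fun x hx => ?_
    have := Finset.mem_range.1 hx
    rw [u1Y_abs, if_neg (by omega), Nat.choose_eq_zero_of_lt (by omega : c + 1 + x - c - 1 < d)]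
    simp
  rw [hmid, add_zero, Int.cast_add]
  congr 1
  · push_cast
    refine Finset.sum_congr rfl fun x hx => ?_
    have := Finset.mem_range.1 hx
    have e := u1Y_abs c d x
    rw [if_pos (by omega)] at e
    have e' : |(u1Y c d x : ℚ)| = ((c - x + d).choose d : ℚ) := by exact_mod_cast e
    rw [e']
  · rw [← Finset.sum_range_reflect]
    push_cast
    refine Finset.sum_congr rfl fun x hx => ?_
    have hx' := Finset.mem_range.1 hx
    have e := u1Y_abs c d (c + 1 + d + (f - x))
    rw [if_neg (by omega),
      show c + 1 + d + (f - x) - c - 1 = f - x + d by omega] at e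
    have e' : |(u1Y c d (c + 1 + d + (f - x)) : ℚ)| = ((f - x + d).choose d : ℚ) := by
      exact_mod_cast e
    rw [e', show c + 1 + d + (f - x) = n - x by omega, Nat.choose_symm (by omega)]

/-- Lemma (U1_nontrivial_existence): if `t ≥ b(n,k)` the U(1) system has the explicit
nontrivial integer solution `y`. -/
theorem U1_nontrivial_existence (n k t : ℕ) (hk : 2 ≤ k) (hkn : k + 1 ≤ n)
    (ht : 0 < t) (htb : u1B n k ≤ (t : ℚ)) :
    ∃ y : ℕ → ℤ,
      (∀ l : ℕ, (y l : ℚ) =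
          (-1) ^ l / (Nat.factorial (n - k - 1) : ℚ) *
            ∏ α ∈ Finset.Icc 1 (n - k - 1),
              ((l : ℚ) - (((k + 1) / 2 : ℕ) : ℚ) - (α : ℚ))) ∧
      U1Nontrivial n y ∧ U1System n k t y := by
  obtain ⟨d, rfl⟩ : ∃ d, n = k + 1 + d := ⟨n - (k + 1), by omega⟩
  have hd : k + 1 + d - k - 1 = d := by omega
  have hd1 : k + 1 + d - k = d + 1 := by omega
  refine ⟨u1Y ((k + 1) / 2) d, ?_, ?_, ?_, ?_⟩
  · rw [hd]; exact u1Y_formula _ _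
  · refine ⟨0, by simp, ?_⟩
    rw [← abs_ne_zero, u1Y_abs, if_pos (Nat.zero_le _)]
    exact_mod_cast (Nat.choose_pos (Nat.le_add_left _ _)).ne'
  · have hs := u1Y_sum ((k + 1) / 2) (k / 2) d (k + 1 + d) (by omega)
    have hb : u1G (k + 1 + d) (d + 1) ((k + 1) / 2) + u1G (k + 1 + d) (d + 1) (k / 2)
        = 2 * u1B (k + 1 + d) k := by
      have hB : u1B (k + 1 + d) k * 2 ^ ((k + 1) / 2)
          = 2 ^ (k / 2) * u1R (d + 1) ((k + 1) / 2) := by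
        unfold u1B u1R
        have hp : ∏ α ∈ Finset.Icc 1 ((k + 1) / 2),
              (((k + 1 + d : ℕ) : ℚ) - (k : ℚ) + 2 * (α : ℚ) - 1)
            = ∏ α ∈ Finset.Icc 1 ((k + 1) / 2), (((d + 1 : ℕ) : ℚ) + 2 * (α : ℚ) - 1) := by
          refine Finset.prod_congr rfl fun α _ => ?_
          push_cast; ring
        rw [hp]
        ring
      rcases Nat.even_or_odd' k with ⟨c, rfl | rfl⟩
      · rw [show (2 * c + 1) / 2 = c by omega, show 2 * c / 2 = c by omega] at *
        rw [show 2 * c + 1 + d = d + 1 + 2 * c by omega] at *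
        rw [u1G_eq_u1R]
        have h2 : (2 : ℚ) ^ c ≠ 0 := by positivity
        have : u1B (d + 1 + 2 * c) (2 * c) = u1R (d + 1) c :=
          mul_right_cancel₀ h2 (by rw [hB]; ring)
        rw [this]; ring
      · rw [show (2 * c + 1 + 1) / 2 = c + 1 by omega, show (2 * c + 1) / 2 = c by omega] at *
        rw [← u1G_pascal, show 2 * c + 1 + 1 + d + 1 = d + 1 + 2 * (c + 1) by omega, u1G_eq_u1R]
        have h2 : (2 : ℚ) ^ c ≠ 0 := by positivity
        refine mul_right_cancel₀ h2 ?_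
        rw [pow_succ] at hB
        linarith
    rw [hb] at hs
    have : ((∑ l ∈ Finset.range (k + 1 + d + 1),
        ((k + 1 + d).choose l : ℤ) * |u1Y ((k + 1) / 2) d l| : ℤ) : ℚ) ≤ 2 * (t : ℚ) := by
      rw [hs]; linarith
    exact_mod_cast this
  · intro j _
    rw [hd1]
    exact u1Y_diff _ _ _
end

section
/- Let n and k be integers with 2 ≤ k ≤ n−1. Assume that b(n,k) ≤ C(n,j) for every integer j with ⌈k/2⌉+1 ≤ j ≤ n−⌈k/2⌉−1, and additionally, when k is odd, that b(n,k) ≤ b(n,k+1). Then for every positive integer t, the U(1) system with parameters (n,k,t) has no nontrivial integer solution if and only if t < b(n,k). -/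
open Finset

/-- Binomial-weighted window sum `((1+E)^m x)(j)`. -/
def u1S (m : ℕ) (x : ℕ → ℤ) (j : ℕ) : ℤ := ∑ i ∈ range (m + 1), (m.choose i : ℤ) * x (j + i)

lemma u1S_succ (m : ℕ) (x : ℕ → ℤ) (j : ℕ) :
    u1S (m + 1) x j = u1S m (fun l => x l + x (l + 1)) j := by
  unfold u1S
  rw [sum_range_succ' _ (m + 1)]
  simp only [Nat.choose_succ_succ', Nat.cast_add, add_mul, mul_add, sum_add_distrib]
  have h1 : ∑ i ∈ range (m + 1), (m.choose (i + 1) : ℤ) * x (j + (i + 1))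
      + ((m + 1).choose 0 : ℤ) * x (j + 0) = ∑ i ∈ range (m + 1), (m.choose i : ℤ) * x (j + i) := by
    have := sum_range_succ' (fun i => (m.choose i : ℤ) * x (j + i)) (m + 1)
    rw [sum_range_succ] at this
    simp at this ⊢
    linarith
  have h2 : ∀ i, x (j + i + 1) = x (j + (i + 1)) := fun i => rfl
  simp only [h2]
  linarith

lemma u1S_comp (k m : ℕ) (x : ℕ → ℤ) (j : ℕ) :
    u1S (k + m) x j = u1S k (fun i => u1S m x i) j := by
  induction k generalizing x j with
  | zero => simp [u1S]
  | succ k ih =>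
    rw [show k + 1 + m = (k + m) + 1 by ring, u1S_succ, ih, u1S_succ]
    congr 1
    funext i
    simp only [u1S, mul_add, sum_add_distrib]
    congr 1
    refine sum_congr rfl fun l _ => ?_
    congr 2
    ring

/-- The basic family of solutions. -/
noncomputable def u1X (c : ℤ) (r : ℕ) (l : ℕ) : ℤ := (-1) ^ l * Ring.choose (c - l) r

lemma u1choose_pascal (z : ℤ) (r : ℕ) :
    Ring.choose z (r + 1) = Ring.choose (z - 1) (r + 1) + Ring.choose (z - 1) r := by
  have := Ring.choose_succ_succ (z - 1) r
  rw [sub_add_cancel] at this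
  linarith

lemma u1S_X (c : ℤ) (r j : ℕ) : u1S (r + 1) (u1X c r) j = 0 := by
  induction r generalizing c with
  | zero => simp [u1S, sum_range_succ, u1X, pow_succ]
  | succ r ih =>
    rw [u1S_succ]
    have : (fun l => u1X c (r + 1) l + u1X c (r + 1) (l + 1)) = u1X (c - 1) r := by
      funext l
      simp only [u1X]
      rw [u1choose_pascal (c - l)]
      push_cast
      rw [show c - ((l : ℤ) + 1) = c - l - 1 by ring, show c - 1 - (l : ℤ) = c - l - 1 by ring]
      ring
    rw [this, ih]

lemma u1choose_nonneg (a r : ℕ) (z : ℤ) (h : z = a) : Ring.choose z r = (a.choose r : ℤ) := by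
  rw [h, Ring.choose_natCast]

lemma u1choose_neg (a r : ℕ) (z : ℤ) (h : z = -(a + 1)) :
    Ring.choose z r = (-1) ^ r * ((a + r).choose r : ℤ) := by
  rw [h, Ring.choose_neg]
  have : (Ring.choose (((a : ℤ) + 1) + r - 1) r) = ((a + r).choose r : ℤ) :=
    u1choose_nonneg _ _ _ (by push_cast; ring)
  rw [this]
  simp [Units.smul_def, Int.negOnePow]

lemma u1_sys_iff (n k t : ℕ) (hkn : k + 1 ≤ n) (x : ℕ → ℤ) :
    U1System n k t x ↔ (∑ l ∈ range (n + 1), (n.choose l : ℤ) * |x l| ≤ 2 * (t : ℤ)) ∧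
      ∀ j ≤ k, u1S (n - k) x j = 0 := by
  unfold U1System
  refine and_congr Iff.rfl ?_
  have : ∀ j, ∑ l ∈ Finset.Icc j (n - k + j), ((n - k).choose (l - j) : ℤ) * x l
      = u1S (n - k) x j := by
    intro j
    unfold u1S
    rw [← Finset.Ico_succ_right_eq_Icc, Finset.sum_Ico_eq_sum_range]
    simp only [Nat.succ_eq_succ, Nat.succ_eq_add_one]
    rw [show n - k + j + 1 - j = n - k + 1 by omega]
    refine sum_congr rfl fun i _ => ?_
    simp
  simp only [this, mem_range, Nat.lt_succ_iff]

/-- A solution vanishing on `m` consecutive places vanishes. -/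
lemma u1_unique (n k m s : ℕ) (hn : n = k + m) (hm : 0 < m) (x : ℕ → ℤ)
    (hx : ∀ j ≤ k, u1S m x j = 0) (hs : s ≤ k + 1)
    (hz : ∀ l, s ≤ l → l < s + m → x l = 0) : ∀ l ≤ n, x l = 0 := by
  have up : ∀ l, s ≤ l → l ≤ n → x l = 0 := by
    intro l
    induction l using Nat.strong_induction_on with
    | _ l ih =>
      intro h1 h2
      by_cases h3 : l < s + m
      · exact hz l h1 h3
      · have := hx (l - m) (by omega)
        unfold u1S at this
        rw [sum_range_succ, sum_eq_zero] at this
        · simpa [show l - m + m = l by omega] using this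
        · intro i hi
          rw [mem_range] at hi
          rw [ih (l - m + i) (by omega) (by omega) (by omega), mul_zero]
  have down : ∀ d, ∀ l, l + d = s → x l = 0 := by
    intro d
    induction d using Nat.strong_induction_on with
    | _ d ih =>
      intro l hl
      rcases Nat.eq_zero_or_pos d with rfl | hd
      · exact hz l (by omega) (by omega)
      · have := hx l (by omega)
        unfold u1S at this
        rw [sum_range_succ', sum_eq_zero] at this
        · simpa using this
        · intro i hi
          rw [mem_range] at hi
          have : x (l + (i + 1)) = 0 := by
            by_cases h : l + (i + 1) < s
            · exact ih (s - (l + (i + 1))) (by omega) _ (by omega)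
            · exact up _ (by omega) (by omega)
          rw [this, mul_zero]
  intro l hl
  by_cases h : s ≤ l
  · exact up l h hl
  · exact down (s - l) l (by omega)

/-- Weighted norm. -/
def u1N (n : ℕ) (x : ℕ → ℤ) : ℤ := ∑ l ∈ range (n + 1), (n.choose l : ℤ) * |x l|

lemma u1N_ge_two (n k m : ℕ) (hn : n = k + m) (x : ℕ → ℤ)
    (hx : ∀ j ≤ k, u1S m x j = 0) (j : ℕ) (hj : j ≤ n) (hxj : x j ≠ 0) :
    2 * (n.choose j : ℤ) ≤ u1N n x := by
  have h0 : u1S n x 0 = 0 := by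
    rw [hn, u1S_comp]
    unfold u1S
    refine sum_eq_zero fun i hi => ?_
    rw [mem_range] at hi
    have := hx (0 + i) (by omega)
    unfold u1S at this
    exact mul_eq_zero_of_right _ this
  unfold u1S at h0
  unfold u1N
  have hmem : j ∈ range (n + 1) := by simp; omega
  rw [← add_sum_erase _ _ hmem] at h0 ⊢
  have h1 : |∑ i ∈ (range (n + 1)).erase j, (n.choose i : ℤ) * x (0 + i)| ≤
      ∑ i ∈ (range (n + 1)).erase j, (n.choose i : ℤ) * |x i| := by
    refine (abs_sum_le_sum_abs _ _).trans (le_of_eq ?_)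
    refine sum_congr rfl fun i _ => ?_
    rw [abs_mul, zero_add, Nat.abs_cast]
  have h2 : |∑ i ∈ (range (n + 1)).erase j, (n.choose i : ℤ) * x (0 + i)|
      = (n.choose j : ℤ) * |x j| := by
    rw [show ∑ i ∈ (range (n + 1)).erase j, (n.choose i : ℤ) * x (0 + i)
      = - ((n.choose j : ℤ) * x j) by rw [zero_add] at h0; linarith, abs_neg, abs_mul, Nat.abs_cast]
  have h3 : 1 ≤ |x j| := Int.one_le_abs hxj
  have h4 : (n.choose j : ℤ) ≤ (n.choose j : ℤ) * |x j| :=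
    le_mul_of_one_le_right (by positivity) h3
  linarith

/-- The one-sided sums as power series coefficients. -/
noncomputable def u1T (N q a : ℕ) : ℤ :=
  PowerSeries.coeff a ((1 + PowerSeries.X : PowerSeries ℤ) ^ N * (PowerSeries.mk 1) ^ q)

lemma u1_coeff_one_add (N i : ℕ) :
    PowerSeries.coeff i ((1 + PowerSeries.X : PowerSeries ℤ) ^ N) = (N.choose i : ℤ) := by
  have : ((1 + PowerSeries.X : PowerSeries ℤ) ^ N)
      = (((1 + Polynomial.X : Polynomial ℤ) ^ N : Polynomial ℤ) : PowerSeries ℤ) := by simp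
  rw [this, Polynomial.coeff_coe, Polynomial.coeff_one_add_X_pow]

lemma u1T_eq (N r a : ℕ) : u1T N (r + 1) a =
    ∑ l ∈ range (a + 1), (N.choose l : ℤ) * ((a - l + r).choose r : ℤ) := by
  unfold u1T
  rw [PowerSeries.coeff_mul, Finset.Nat.sum_antidiagonal_eq_sum_range_succ_mk]
  refine sum_congr rfl fun l _ => ?_
  rw [u1_coeff_one_add, PowerSeries.mk_one_pow_eq_mk_choose_add, PowerSeries.coeff_mk, add_comm r]

lemma u1T_rec (q a : ℕ) : u1T (2 * (a + 1) + (q + 2)) (q + 2) (a + 1) =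
    u1T (2 * (a + 1) + q) q (a + 1) + 4 * u1T (2 * a + (q + 2)) (q + 2) a := by
  unfold u1T
  set g : PowerSeries ℤ := PowerSeries.mk 1
  have hg : g * (1 - PowerSeries.X) = 1 := PowerSeries.mk_one_mul_one_sub_eq_one ℤ
  set Y : PowerSeries ℤ := PowerSeries.X with hY
  have key : (1 + Y) ^ (2 * (a + 1) + (q + 2)) * g ^ (q + 2) =
      (1 + Y) ^ (2 * (a + 1) + q) * g ^ q
        + Y * (4 * ((1 + Y) ^ (2 * a + (q + 2)) * g ^ (q + 2))) := by
    have e : (1 + Y) ^ (2 * (a + 1) + q) * g ^ q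
        = (1 + Y) ^ (2 * (a + 1) + q) * g ^ q * (g * (1 - Y)) ^ 2 := by rw [hg]; ring
    rw [e]
    ring
  rw [key, map_add, hY, PowerSeries.coeff_succ_X_mul]
  congr 1
  rw [show (4 : PowerSeries ℤ) = PowerSeries.C (4 : ℤ) by simp, PowerSeries.coeff_C_mul]

lemma u1T_pascal (N q a : ℕ) : u1T (N + 1) q (a + 1) = u1T N q (a + 1) + u1T N q a := by
  unfold u1T
  rw [show (1 + PowerSeries.X : PowerSeries ℤ) ^ (N + 1) * (PowerSeries.mk 1) ^ q =
    (1 + PowerSeries.X : PowerSeries ℤ) ^ N * (PowerSeries.mk 1) ^ q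
    + PowerSeries.X * ((1 + PowerSeries.X : PowerSeries ℤ) ^ N * (PowerSeries.mk 1) ^ q) by ring,
    map_add, PowerSeries.coeff_succ_X_mul]

lemma u1T_zero (N q : ℕ) : u1T N q 0 = 1 := by
  simp [u1T]

lemma u1prod_shift (q a : ℕ) : ∏ i ∈ range (a + 1), ((q : ℤ) + 2 * i + 1) =
    (q + 1) * ∏ i ∈ range a, (((q + 2 : ℕ) : ℤ) + 2 * i + 1) := by
  rw [prod_range_succ', mul_comm]
  simp only [Nat.cast_zero, mul_zero, add_zero]
  congr 1
  refine prod_congr rfl fun i _ => ?_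
  push_cast; ring

lemma u1T_formula (q a : ℕ) : (a.factorial : ℤ) * u1T (2 * a + q) q a =
    2 ^ a * ∏ i ∈ range a, ((q : ℤ) + 2 * i + 1) := by
  induction q using Nat.twoStepInduction generalizing a with
  | zero =>
    have h : u1T (2 * a + 0) 0 a = (a.centralBinom : ℤ) := by
      unfold u1T
      rw [pow_zero, mul_one, u1_coeff_one_add]; rfl
    rw [h]
    clear h
    induction a with
    | zero => simp
    | succ a ih =>
      have := Nat.succ_mul_centralBinom_succ a
      have h2 : ((a : ℤ) + 1) * ((a + 1).centralBinom : ℤ) = 2 * (2 * a + 1) * a.centralBinom := by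
        exact_mod_cast this
      rw [prod_range_succ, Nat.factorial_succ]
      push_cast at ih ⊢
      calc ((a : ℤ) + 1) * a.factorial * ((a + 1).centralBinom : ℤ)
          = a.factorial * (((a : ℤ) + 1) * ((a + 1).centralBinom : ℤ)) := by ring
        _ = 2 * (2 * a + 1) * (a.factorial * a.centralBinom) := by rw [h2]; ring
        _ = _ := by rw [ih]; ring
  | one =>
    have h : u1T (2 * a + 1) 1 a = 4 ^ a := by
      rw [u1T_eq (2 * a + 1) 0 a]
      have := Nat.sum_range_choose_halfway a
      simp only [Nat.choose_zero_right, Nat.cast_one, mul_one]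
      exact_mod_cast this
    rw [h]
    clear h
    induction a with
    | zero => simp
    | succ a ih =>
      rw [prod_range_succ, Nat.factorial_succ]
      push_cast at ih ⊢
      rw [show ((a : ℤ) + 1) * a.factorial * 4 ^ (a + 1)
        = 4 * (a + 1) * (a.factorial * 4 ^ a) by ring, ih]
      ring
  | more q ih0 _ =>
    induction a with
    | zero => simp [u1T_zero]
    | succ a iha =>
      rw [u1T_rec, mul_add, ih0 (a + 1), u1prod_shift, prod_range_succ, Nat.factorial_succ]
      push_cast at iha ⊢
      rw [show ((a : ℤ) + 1) * a.factorial * (4 * u1T (2 * a + (q + 2)) (q + 2) a)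
        = 4 * (a + 1) * (a.factorial * u1T (2 * a + (q + 2)) (q + 2) a) by ring, iha]
      ring

lemma u1N_X (n A B r : ℕ) (c : ℤ) (hc : c = A + r) (hn : n = A + r + B + 1) :
    u1N n (u1X c r) = u1T n (r + 1) A + u1T n (r + 1) B := by
  unfold u1N
  have habs : ∀ l, |u1X c r l| = |Ring.choose (c - l) r| := by
    intro l; simp [u1X, abs_mul]
  simp only [habs]
  rw [show n + 1 = (A + 1) + r + (B + 1) by omega, sum_range_add, sum_range_add, u1T_eq, u1T_eq]
  have hz : ∑ i ∈ range r, (n.choose (A + 1 + i) : ℤ) *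
      |Ring.choose (c - ((A + 1 + i : ℕ) : ℤ)) r| = 0 := by
    refine sum_eq_zero fun i hi => ?_
    rw [mem_range] at hi
    rw [u1choose_nonneg (r - 1 - i) r _ (by omega),
      Nat.choose_eq_zero_of_lt (show r - 1 - i < r by omega)]
    simp
  rw [hz, add_zero]
  congr 1
  · refine sum_congr rfl fun l hl => ?_
    rw [mem_range] at hl
    rw [u1choose_nonneg (A - l + r) r _ (by omega), Nat.abs_cast]
  · rw [← sum_range_reflect]
    refine sum_congr rfl fun l hl => ?_
    rw [mem_range] at hl
    rw [u1choose_neg (B - l) r _ (by omega), abs_mul, abs_pow, abs_neg, abs_one, one_pow, one_mul,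
      Nat.abs_cast, ← Nat.choose_symm (show l ≤ n by omega)]
    congr 3
    omega

lemma u1B_eq (n k r : ℕ) (hn : n = k + 1 + r) (A : ℕ) (hA : A = (k + 1) / 2 ∨ A = k / 2) :
    ((u1N n (u1X (A + r) r) : ℤ) : ℚ) = 2 * u1B n k := by
  have main : u1T n (r + 1) ((k + 1) / 2) + u1T n (r + 1) (k / 2) = u1N n (u1X (A + r) r) := by
    rcases hA with rfl | rfl
    · rw [u1N_X n ((k + 1) / 2) (k / 2) r _ rfl (by omega)]
    · rw [u1N_X n (k / 2) ((k + 1) / 2) r _ rfl (by omega), add_comm]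
  rw [← main]
  have hP : ∀ s : ℕ, ∏ α ∈ Finset.Icc 1 s, ((n : ℚ) - (k : ℚ) + 2 * (α : ℚ) - 1)
      = ((∏ i ∈ range s, (((r + 1 : ℕ) : ℤ) + 2 * i + 1) : ℤ) : ℚ) := by
    intro s
    rw [← Finset.Ico_succ_right_eq_Icc, Finset.prod_Ico_eq_prod_range]
    push_cast
    refine prod_congr (by simp) fun i _ => ?_
    rw [hn]; push_cast; ring
  unfold u1B
  rw [hP]
  have hf : (((k + 1) / 2).factorial : ℚ) ≠ 0 := by positivity
  rw [div_mul_eq_mul_div, mul_div_assoc', eq_div_iff hf]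
  obtain ⟨s, rfl | rfl⟩ : ∃ s, k = 2 * s ∨ k = 2 * s + 1 := ⟨k / 2, by omega⟩
  · rw [show (2 * s + 1) / 2 = s by omega, show 2 * s / 2 = s by omega]
    have := u1T_formula (r + 1) s
    rw [show 2 * s + (r + 1) = n by omega] at this
    have h2 : (s.factorial : ℚ) * ((u1T n (r + 1) s : ℤ) : ℚ) = 2 ^ s *
      ((∏ i ∈ range s, (((r + 1 : ℕ) : ℤ) + 2 * i + 1) : ℤ) : ℚ) := by exact_mod_cast this
    rw [← h2]; push_cast; ring
  · rw [show (2 * s + 1 + 1) / 2 = s + 1 by omega, show (2 * s + 1) / 2 = s by omega]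
    have := u1T_formula (r + 1) (s + 1)
    rw [show 2 * (s + 1) + (r + 1) = n + 1 by omega, u1T_pascal] at this
    have h2 : ((s + 1).factorial : ℚ) * ((u1T n (r + 1) (s + 1) + u1T n (r + 1) s : ℤ) : ℚ)
      = 2 ^ (s + 1) *
      ((∏ i ∈ range (s + 1), (((r + 1 : ℕ) : ℤ) + 2 * i + 1) : ℤ) : ℚ) := by exact_mod_cast this
    rw [mul_comm, h2]; ring

lemma u1S_sub (m : ℕ) (x y : ℕ → ℤ) (j : ℕ) :
    u1S m (fun l => x l - y l) j = u1S m x j - u1S m y j := by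
  simp [u1S, mul_sub, sum_sub_distrib]

lemma u1S_smul (m : ℕ) (a : ℤ) (x : ℕ → ℤ) (j : ℕ) :
    u1S m (fun l => a * x l) j = a * u1S m x j := by
  simp only [u1S, mul_sum]
  exact sum_congr rfl fun i _ => by ring

lemma u1N_congr (n : ℕ) (x y : ℕ → ℤ) (h : ∀ l ≤ n, x l = y l) : u1N n x = u1N n y := by
  unfold u1N
  refine sum_congr rfl fun l hl => ?_
  rw [h l (by simpa [Nat.lt_succ_iff] using hl)]

lemma u1N_smul (n : ℕ) (a : ℤ) (x : ℕ → ℤ) : u1N n (fun l => a * x l) = |a| * u1N n x := by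
  simp only [u1N, mul_sum, abs_mul]
  exact sum_congr rfl fun i _ => by ring

lemma u1N_sub_le (n : ℕ) (x y : ℕ → ℤ) : u1N n (fun l => x l - y l) ≤ u1N n x + u1N n y := by
  simp only [u1N, ← sum_add_distrib, ← mul_add]
  exact sum_le_sum fun i _ => mul_le_mul_of_nonneg_left (abs_sub _ _) (by positivity)

/-- `c * x_s` style representation: a solution supported as `u1X (A+r) r` is a multiple of it. -/
lemma u1_multiple (n k r A : ℕ) (hn : n = k + 1 + r) (hA : A ≤ k) (x : ℕ → ℤ)
    (hx : ∀ j ≤ k, u1S (r + 1) x j = 0) (hz : ∀ l, A < l → l ≤ A + r → x l = 0) :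
    ∃ a : ℤ, ∀ l ≤ n, x l = a * u1X (A + r) r l := by
  refine ⟨(-1) ^ A * x A, ?_⟩
  have := u1_unique n k (r + 1) A (by omega) (by omega)
    (fun l => x l - ((-1) ^ A * x A) * u1X (A + r) r l) ?_ (by omega) ?_
  · intro l hl
    have := this l hl
    linarith
  · intro j hj
    rw [u1S_sub, u1S_smul, u1S_X, hx j hj]; simp
  · intro l h1 h2
    rcases Nat.eq_or_lt_of_le h1 with rfl | h1
    · simp only [u1X]
      rw [u1choose_nonneg r r _ (by ring), Nat.choose_self]
      have : ((-1 : ℤ) ^ A) * (-1) ^ A = 1 := by rw [← mul_pow]; simp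
      push_cast
      linear_combination (-x A) * this
    · simp only [u1X]
      rw [hz l h1 (by omega), u1choose_nonneg (A + r - l) r _ (by omega),
        Nat.choose_eq_zero_of_lt (by omega)]
      simp

lemma u1X_mul_nonneg (c : ℤ) (r : ℕ) (hr : 0 < r) (l : ℕ) :
    0 ≤ u1X c r l * u1X (c - 1) r l := by
  simp only [u1X]
  have e : ((-1 : ℤ) ^ l) * (-1) ^ l = 1 := by rw [← mul_pow]; simp
  rw [show ((-1 : ℤ) ^ l * Ring.choose (c - l) r) * ((-1) ^ l * Ring.choose (c - 1 - l) r)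
    = (((-1 : ℤ) ^ l) * (-1) ^ l) * (Ring.choose (c - l) r * Ring.choose (c - 1 - l) r) by ring,
    e, one_mul]
  rcases lt_trichotomy (c - (l : ℤ)) 0 with h | h | h
  · rw [u1choose_neg (-(c - l) - 1).toNat r (c - l) (by omega),
      u1choose_neg (-(c - l)).toNat r (c - 1 - l) (by omega)]
    have e : ((-1 : ℤ) ^ r) * (-1) ^ r = 1 := by rw [← mul_pow]; simp
    rw [mul_mul_mul_comm, e]
    positivity
  · rw [u1choose_nonneg 0 r (c - l) (by omega), Nat.choose_eq_zero_of_lt hr]; simp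
  · rw [u1choose_nonneg (c - l).toNat r (c - l) (by omega),
      u1choose_nonneg (c - l - 1).toNat r (c - 1 - l) (by omega)]
    positivity

lemma u1_abs_add (a b u v : ℤ) (hab : 0 ≤ a * b) (huv : 0 ≤ u * v) :
    |a * u + b * v| = |a| * |u| + |b| * |v| := by
  have h : 0 ≤ (a * u) * (b * v) := by
    rw [mul_mul_mul_comm]; exact mul_nonneg hab huv
  rw [← abs_mul, ← abs_mul]
  rw [abs_add_eq_add_abs_iff]
  rcases mul_nonneg_iff.mp h with h | h
  · exact Or.inl h
  · exact Or.inr h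

/-- Lower bound in the two-dimensional case. -/
lemma u1_plane (n : ℕ) (u v w : ℕ → ℤ) (M : ℤ) (hM : 0 ≤ M) (hu : u1N n u = M) (hv : u1N n v = M)
    (hw : M ≤ u1N n w) (huvw : ∀ l, w l = u l - v l) (huv : ∀ l, 0 ≤ u l * v l)
    (a b : ℤ) (hab : a ≠ 0 ∨ b ≠ 0) : M ≤ u1N n (fun l => a * u l + b * v l) := by
  rcases le_or_gt 0 (a * b) with h | h
  · have : u1N n (fun l => a * u l + b * v l) = |a| * u1N n u + |b| * u1N n v := by
      simp only [u1N, mul_sum, ← sum_add_distrib]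
      refine sum_congr rfl fun l _ => ?_
      rw [u1_abs_add _ _ _ _ h (huv l)]; ring
    rw [this, hu, hv]
    have : 1 ≤ |a| + |b| := by
      rcases hab with h | h
      · have := Int.one_le_abs h; have := abs_nonneg b; linarith
      · have := Int.one_le_abs h; have := abs_nonneg a; linarith
    nlinarith
  · -- positive-parameter version
    have pos : ∀ α β : ℤ, 0 < α → 0 < β → M ≤ u1N n (fun l => α * u l - β * v l) := by
      intro α β hα hβ
      rcases le_total β α with hle | hle
      · have h1 := u1N_sub_le n (fun l => α * u l - β * v l) (fun l => (α - β) * v l)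
        have h2 : u1N n (fun l => (α * u l - β * v l) - (α - β) * v l) = |α| * u1N n w := by
          rw [← u1N_smul]
          refine u1N_congr _ _ _ fun l _ => ?_
          rw [huvw l]; ring
        rw [h2, u1N_smul, hv, abs_of_pos hα, abs_of_nonneg (by linarith)] at h1
        nlinarith
      · have h1 := u1N_sub_le n (fun l => α * u l - β * v l) (fun l => (α - β) * u l)
        have h2 : u1N n (fun l => (α * u l - β * v l) - (α - β) * u l) = |β| * u1N n w := by
          rw [← u1N_smul]
          refine u1N_congr _ _ _ fun l _ => ?_
          rw [huvw l]; ring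
        rw [h2, u1N_smul, hu, abs_of_pos hβ, abs_of_nonpos (by linarith)] at h1
        nlinarith
    rcases mul_neg_iff.mp h with ⟨ha, hb⟩ | ⟨ha, hb⟩
    · have := pos a (-b) ha (by linarith)
      refine this.trans (le_of_eq (u1N_congr _ _ _ fun l _ => by ring))
    · have := pos (-a) b (by linarith) hb
      refine this.trans (le_of_eq ?_)
      unfold u1N
      refine sum_congr rfl fun l _ => ?_
      rw [← abs_neg]
      congr 2; ring

lemma u1_lower (n k r : ℕ) (hk : 2 ≤ k) (hn : n = k + 1 + r)
    (hbinom : ∀ j : ℕ, (k + 1) / 2 + 1 ≤ j → j ≤ n - (k + 1) / 2 - 1 →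
      u1B n k ≤ (n.choose j : ℚ))
    (hodd : Odd k → u1B n k ≤ u1B n (k + 1)) (x : ℕ → ℤ)
    (hx : ∀ j ≤ k, u1S (r + 1) x j = 0) (hnt : ∃ l ≤ n, x l ≠ 0) :
    2 * u1B n k ≤ ((u1N n x : ℤ) : ℚ) := by
  by_cases hmid : ∃ j, (k + 1) / 2 + 1 ≤ j ∧ j ≤ n - (k + 1) / 2 - 1 ∧ x j ≠ 0
  · obtain ⟨j, h1, h2, h3⟩ := hmid
    have h4 := u1N_ge_two n k (r + 1) (by omega) x hx j (by omega) h3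
    have h5 : 2 * (n.choose j : ℚ) ≤ ((u1N n x : ℤ) : ℚ) := by exact_mod_cast h4
    have := hbinom j h1 h2
    linarith
  push Not at hmid
  have hNu := u1B_eq n k r hn _ (Or.inl rfl)
  have hnn : ∀ y, 0 ≤ u1N n y := fun y => sum_nonneg fun i _ => by positivity
  by_cases hline : ∀ l, (k + 1) / 2 < l → l ≤ (k + 1) / 2 + r → x l = 0
  · obtain ⟨a, ha⟩ := u1_multiple n k r ((k + 1) / 2) hn (by omega) x hx hline
    have ha0 : a ≠ 0 := by
      rintro rfl
      obtain ⟨l, hl, h⟩ := hnt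
      exact h (by simp [ha l hl])
    rw [u1N_congr n _ _ ha, u1N_smul, ← hNu]
    have := Int.one_le_abs ha0
    have h2 := hnn (u1X (((k + 1) / 2 : ℕ) + r) r)
    exact_mod_cast le_mul_of_one_le_left h2 this
  · -- odd case, two parameters
    push Not at hline
    obtain ⟨l0, h1, h2, h3⟩ := hline
    have hko : k = 2 * (k / 2) + 1 := by
      by_contra hne
      exact h3 (hmid l0 (by omega) (by omega))
    obtain ⟨s, rfl⟩ : ∃ s, k = 2 * s + 1 := ⟨k / 2, hko⟩
    obtain ⟨r, rfl⟩ : ∃ r', r = r' + 1 := ⟨r - 1, by omega⟩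
    have hS : (2 * s + 1 + 1) / 2 = s + 1 := by omega
    have hS' : (2 * s + 1) / 2 = s := by omega
    rw [hS] at hNu hmid h1 h2
    have hNv := u1B_eq n (2 * s + 1) (r + 1) hn s (Or.inr hS'.symm)
    have hNw := u1B_eq n (2 * s + 1 + 1) r (by omega) (s + 1) (Or.inr hS.symm)
    have hod := hodd ⟨s, rfl⟩
    set u := u1X (((s + 1 : ℕ) : ℤ) + ((r + 1 : ℕ) : ℤ)) (r + 1) with hu
    set v := u1X ((s : ℤ) + ((r + 1 : ℕ) : ℤ)) (r + 1) with hv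
    set w := u1X (((s + 1 : ℕ) : ℤ) + (r : ℤ)) r with hw
    have hvu : v = u1X ((((s + 1 : ℕ) : ℤ) + ((r + 1 : ℕ) : ℤ)) - 1) (r + 1) := by
      rw [hv]; congr 1; push_cast; ring
    have huv : ∀ l, 0 ≤ u l * v l := by
      intro l
      rw [hvu, hu]
      exact u1X_mul_nonneg _ _ (by omega) l
    have huvw : ∀ l, w l = u l - v l := by
      intro l
      simp only [hu, hv, hw, u1X]
      rw [u1choose_pascal (((s + 1 : ℕ) : ℤ) + ((r + 1 : ℕ) : ℤ) - l)]
      push_cast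
      rw [show (s : ℤ) + 1 + (r + 1) - l - 1 = s + 1 + r - l by ring,
        show (s : ℤ) + (r + 1) - l = s + 1 + r - l by ring]
      ring
    -- representation
    set p := s + 1 + (r + 1) with hp
    have hvp : v p = (-1) ^ p * (-1) ^ (r + 1) := by
      simp only [hv, u1X]
      rw [u1choose_neg 0 (r + 1) _ (by rw [hp]; push_cast; ring)]
      simp
    have hvp2 : v p * v p = 1 := by
      rw [hvp, mul_mul_mul_comm, ← mul_pow, ← mul_pow]
      simp
    obtain ⟨a, ha⟩ := u1_multiple n (2 * s + 1) (r + 1) (s + 1) hn (by omega)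
      (fun l => x l - (v p * x p) * v l)
      (by
        intro j hj
        rw [u1S_sub, u1S_smul, hx j hj, hv, u1S_X]; simp)
      (by
        intro l hl1 hl2
        rcases Nat.eq_or_lt_of_le hl2 with rfl | hl3
        · linear_combination (- x p) * hvp2
        · have hvl : v l = 0 := by
            simp only [hv, u1X]
            rw [u1choose_nonneg (s + (r + 1) - l) (r + 1) _ (by omega),
              Nat.choose_eq_zero_of_lt (by omega)]
            simp
          simp only [hvl, mul_zero, sub_zero]
          exact hmid l (by omega) (by omega))
    have hrep : ∀ l ≤ n, x l = a * u l + (v p * x p) * v l := by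
      intro l hl
      have := ha l hl
      linarith
    have huvN : u1N n v = u1N n u := by
      have : ((u1N n v : ℤ) : ℚ) = ((u1N n u : ℤ) : ℚ) := by rw [hNv, hNu]
      exact_mod_cast this
    have hwN : u1N n u ≤ u1N n w := by
      have : ((u1N n u : ℤ) : ℚ) ≤ ((u1N n w : ℤ) : ℚ) := by rw [hNw, hNu]; linarith
      exact_mod_cast this
    have hab : a ≠ 0 ∨ v p * x p ≠ 0 := by
      by_contra hcon
      push Not at hcon
      obtain ⟨l, hl, h⟩ := hnt
      exact h (by rw [hrep l hl, hcon.1, hcon.2]; ring)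
    rw [u1N_congr n _ _ hrep, ← hNu]
    exact_mod_cast u1_plane n u v w _ (hnn u) rfl huvN hwN huvw huv a _ hab

/-- Lemma (U1_nontrivial_nonexistence): under the stated binomial hypotheses,
the U(1) system has no nontrivial integer solution iff `t < b(n,k)`. -/
theorem U1_nontrivial_nonexistence (n k : ℕ) (hk : 2 ≤ k) (hkn : k + 1 ≤ n)
    (hbinom : ∀ j : ℕ, (k + 1) / 2 + 1 ≤ j → j ≤ n - (k + 1) / 2 - 1 →
      u1B n k ≤ (n.choose j : ℚ))
    (hodd : Odd k → u1B n k ≤ u1B n (k + 1)) :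
    ∀ t : ℕ, 0 < t →
      ((¬ ∃ x : ℕ → ℤ, U1Nontrivial n x ∧ U1System n k t x) ↔ (t : ℚ) < u1B n k) := by
  intro t _
  obtain ⟨r, hr⟩ : ∃ r, n = k + 1 + r := ⟨n - (k + 1), by omega⟩
  have hm : n - k = r + 1 := by omega
  constructor
  · intro h
    by_contra hlt
    push Not at hlt
    refine h ⟨u1X (((k + 1) / 2 : ℕ) + r) r, ⟨(k + 1) / 2, ?_, ?_⟩, ?_⟩
    · simp; omega
    · simp only [u1X]
      rw [u1choose_nonneg r r _ (by ring), Nat.choose_self]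
      simp
    · rw [u1_sys_iff n k t hkn, hm]
      refine ⟨?_, fun j _ => u1S_X _ _ _⟩
      have := u1B_eq n k r hr _ (Or.inl rfl)
      have h2 : ((u1N n (u1X (((k + 1) / 2 : ℕ) + r) r) : ℤ) : ℚ) ≤ 2 * (t : ℚ) := by
        rw [this]; linarith
      exact_mod_cast h2
  · rintro hlt ⟨x, ⟨l, hl, hxl⟩, hsys⟩
    rw [u1_sys_iff n k t hkn, hm] at hsys
    have h1 := u1_lower n k r hk hr hbinom hodd x hsys.2
      ⟨l, by simpa [Nat.lt_succ_iff] using hl, hxl⟩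
    have h2 : ((u1N n x : ℤ) : ℚ) ≤ 2 * (t : ℚ) := by
      have := hsys.1
      unfold u1N
      exact_mod_cast this
    linarith
end

section
/- Let n and k be integers with k ≥ 2 and n ≥ 2^k. Then b(n,k) ≤ C(n, ⌈k/2⌉+1). Moreover, when k is odd, b(n,k) ≤ b(n,k+1). -/
lemma u1B_range (n k : ℕ) : u1B n k = (2 ^ (k / 2) / (Nat.factorial ((k + 1) / 2) : ℚ)) *
    ∏ i ∈ Finset.range ((k + 1) / 2), ((n : ℚ) - k + 2 * i + 1) := by
  unfold u1B
  congr 1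
  have h : Finset.Icc 1 ((k + 1) / 2) = Finset.Ico 1 ((k + 1) / 2 + 1) := by
    ext x; simp only [Finset.mem_Icc, Finset.mem_Ico]; omega
  rw [h, Finset.prod_Ico_eq_prod_range]
  apply Finset.prod_congr rfl
  intro i _
  push_cast
  ring

lemma u1_choose (e m : ℕ) : (((e + m).choose (m + 1) : ℕ) : ℚ) * ((m + 1) * m.factorial) =
    ∏ i ∈ Finset.range (m + 1), ((e : ℚ) + i) := by
  have h := Nat.ascFactorial_eq_factorial_mul_choose' e (m + 1)
  rw [Nat.ascFactorial_eq_prod_range] at h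
  have h2 : e + (m + 1) - 1 = e + m := by omega
  rw [h2, Nat.factorial_succ] at h
  have h3 : ((∏ i ∈ Finset.range (m + 1), (e + i) : ℕ) : ℚ) =
    (((m + 1) * m.factorial * (e + m).choose (m + 1) : ℕ) : ℚ) := by rw [h]
  push_cast at h3
  rw [h3]; ring

lemma u1_finish (c P C m f : ℚ) (hf : 0 < f) (hm : 0 < m + 1)
    (h : c * (m + 1) * P ≤ C * ((m + 1) * f)) : c / f * P ≤ C := by
  rw [div_mul_eq_mul_div, div_le_iff₀ hf]
  refine le_of_mul_le_mul_left ?_ hm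
  linarith

lemma u1_even (n m : ℕ) (hn : 2 ^ (2 * m) ≤ n) :
    u1B n (2 * m) ≤ (n.choose (m + 1) : ℚ) := by
  have h1 : m + 1 ≤ 2 ^ m := Nat.lt_two_pow_self
  have h2 : 2 ^ m * (m + 1) ≤ n := by
    rw [two_mul, pow_add] at hn
    exact (Nat.mul_le_mul_left _ h1).trans hn
  have h0 : 2 * m + 1 ≤ n + 1 := by nlinarith
  rw [u1B_range]
  have e1 : 2 * m / 2 = m := by omega
  have e2 : (2 * m + 1) / 2 = m := by omega
  rw [e1, e2]
  obtain ⟨e, rfl⟩ : ∃ e, n = e + m := ⟨n - m, by omega⟩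
  apply u1_finish _ _ _ (m : ℚ) _ (by positivity) (by positivity)
  rw [u1_choose, Finset.prod_range_succ, mul_comm]
  have h0' : (m : ℚ) ≤ e := by exact_mod_cast (by omega : m ≤ e)
  have h2' : (2 : ℚ) ^ m * (m + 1) ≤ e + m := by exact_mod_cast h2
  apply mul_le_mul _ h2' (by positivity) (by positivity)
  apply Finset.prod_le_prod
  · intro i _
    push_cast
    have : (0 : ℚ) ≤ i := by positivity
    linarith
  · intro i hi
    have : (i : ℚ) + 1 ≤ m := by exact_mod_cast Finset.mem_range.mp hi
    push_cast
    linarith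

lemma u1_pow (p : ℕ) : p + 3 ≤ 2 ^ (p + 1) + 1 ∧ p + 2 ≤ 2 ^ (p + 1) := by
  have : p + 1 < 2 ^ (p + 1) := Nat.lt_two_pow_self
  omega

lemma u1_odd (n p : ℕ) (hn : 2 ^ (2 * p + 3) ≤ n) :
    u1B n (2 * p + 3) ≤ (n.choose (p + 2 + 1) : ℚ) := by
  have h1 : p + 2 ≤ 2 ^ (p + 1) := (u1_pow p).2
  have hp : 2 ^ (2 * p + 3) = 2 * (2 ^ (p + 1) * 2 ^ (p + 1)) := by ring
  have h2 : 2 ^ (p + 1) * (p + 3) + (p + 2) ≤ n := by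
    rw [hp] at hn
    nlinarith
  have h0 : 2 * (p + 2) ≤ n := by nlinarith
  rw [u1B_range]
  have e1 : (2 * p + 3) / 2 = p + 1 := by omega
  have e2 : (2 * p + 3 + 1) / 2 = p + 2 := by omega
  rw [e1, e2]
  obtain ⟨e, rfl⟩ : ∃ e, n = e + (p + 2) := ⟨n - (p + 2), by omega⟩
  apply u1_finish _ _ _ ((p + 2 : ℕ) : ℚ) _ (by positivity) (by positivity)
  rw [u1_choose, Finset.prod_range_succ' _ (p + 2), mul_comm]
  have h0' : (p : ℚ) + 2 ≤ e := by exact_mod_cast (by omega : p + 2 ≤ e)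
  have h2' : (2 : ℚ) ^ (p + 1) * ((p + 2 : ℕ) + 1) ≤ e + (0 : ℕ) := by
    exact_mod_cast (by omega : 2 ^ (p + 1) * (p + 3) ≤ e)
  apply mul_le_mul _ h2' (by positivity) (by positivity)
  apply Finset.prod_le_prod
  · intro i _
    push_cast
    have : (0 : ℚ) ≤ i := by positivity
    linarith
  · intro i hi
    have : (i : ℚ) + 1 ≤ (p + 2 : ℕ) := by exact_mod_cast Finset.mem_range.mp hi
    push_cast at this ⊢
    linarith

lemma u1_ratio (d : ℚ) (hd : 0 ≤ d) (j : ℕ) :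
    (∏ i ∈ Finset.range j, (d + 2 * i + 2)) * d ≤
      (∏ i ∈ Finset.range j, (d + 2 * i + 1)) * (d + j) := by
  induction j with
  | zero => simp
  | succ j ih =>
    rw [Finset.prod_range_succ, Finset.prod_range_succ]
    have hQ : 0 ≤ ∏ i ∈ Finset.range j, (d + 2 * (i : ℚ) + 1) :=
      Finset.prod_nonneg fun i _ => by positivity
    have hj : (0 : ℚ) ≤ j := by positivity
    have s1 := mul_le_mul_of_nonneg_right ih (by positivity : 0 ≤ d + 2 * (j : ℚ) + 2)
    have s2 : (d + j) * (d + 2 * j + 2) ≤ (d + 2 * j + 1) * (d + (j + 1)) := by nlinarith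
    have s3 := mul_le_mul_of_nonneg_left s2 hQ
    push_cast
    linarith

lemma u1_second (n p : ℕ) (hn : 2 ^ (2 * p + 3) ≤ n) :
    u1B n (2 * p + 3) ≤ u1B n (2 * p + 3 + 1) := by
  have h1 : p + 2 ≤ 2 ^ (p + 1) := (u1_pow p).2
  have hp : 2 ^ (2 * p + 3) = 2 * (2 ^ (p + 1) * 2 ^ (p + 1)) := by ring
  have h0 : 3 * (p + 2) ≤ n := by nlinarith
  rw [u1B_range, u1B_range]
  have e1 : (2 * p + 3) / 2 = p + 1 := by omega
  have e2 : (2 * p + 3 + 1) / 2 = p + 2 := by omega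
  have e3 : (2 * p + 3 + 1 + 1) / 2 = p + 2 := by omega
  rw [e1, e2, e3]
  obtain ⟨e, rfl⟩ : ∃ e, n = e + 2 * (p + 2) := ⟨n - 2 * (p + 2), by omega⟩
  have h0' : (p : ℚ) + 2 ≤ e := by exact_mod_cast (by omega : p + 2 ≤ e)
  have r := u1_ratio (e : ℚ) (by positivity) (p + 2)
  have hQ : 0 ≤ ∏ i ∈ Finset.range (p + 2), ((e : ℚ) + 2 * (i : ℚ) + 1) :=
    Finset.prod_nonneg fun i _ => by positivity
  have a1 : ∏ i ∈ Finset.range (p + 2),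
      (((e + 2 * (p + 2) : ℕ) : ℚ) - ((2 * p + 3 : ℕ) : ℚ) + 2 * i + 1) =
      ∏ i ∈ Finset.range (p + 2), ((e : ℚ) + 2 * (i : ℚ) + 2) :=
    Finset.prod_congr rfl fun i _ => by push_cast; ring
  have a2 : ∏ i ∈ Finset.range (p + 2),
      (((e + 2 * (p + 2) : ℕ) : ℚ) - ((2 * p + 3 + 1 : ℕ) : ℚ) + 2 * i + 1) =
      ∏ i ∈ Finset.range (p + 2), ((e : ℚ) + 2 * (i : ℚ) + 1) :=
    Finset.prod_congr rfl fun i _ => by push_cast; ring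
  rw [a1, a2]
  have he : (0 : ℚ) < e := by
    have : (0 : ℚ) ≤ p := by positivity
    linarith
  have key : ∏ i ∈ Finset.range (p + 2), ((e : ℚ) + 2 * (i : ℚ) + 2) ≤
      2 * ∏ i ∈ Finset.range (p + 2), ((e : ℚ) + 2 * (i : ℚ) + 1) := by
    refine le_of_mul_le_mul_right ?_ he
    refine r.trans ?_
    push_cast
    have := mul_le_mul_of_nonneg_left h0' hQ
    linarith
  have := mul_le_mul_of_nonneg_left key
    (by positivity : (0 : ℚ) ≤ 2 ^ (p + 1) / ((p + 2).factorial : ℚ))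
  refine this.trans (le_of_eq ?_)
  rw [pow_succ 2 (p + 1)]
  ring

/-- Lemma (U1_sufficient_cond): if `n ≥ 2^k` then `b(n,k) ≤ C(n,⌈k/2⌉+1)`, and
for odd `k` also `b(n,k) ≤ b(n,k+1)`. -/
theorem U1_sufficient_cond (n k : ℕ) (hk : 2 ≤ k) (hn : 2 ^ k ≤ n) :
    u1B n k ≤ (n.choose ((k + 1) / 2 + 1) : ℚ) ∧
      (Odd k → u1B n k ≤ u1B n (k + 1)) := by
  rcases Nat.even_or_odd' k with ⟨m, h | h⟩
  · subst h
    have e2 : (2 * m + 1) / 2 = m := by omega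
    rw [e2]
    refine ⟨u1_even n m hn, fun ho => ?_⟩
    obtain ⟨r, hr⟩ := ho
    omega
  · obtain ⟨p, rfl⟩ : ∃ p, m = p + 1 := ⟨m - 1, by omega⟩
    obtain rfl : k = 2 * p + 3 := by omega
    have e2 : (2 * p + 3 + 1) / 2 = p + 2 := by omega
    rw [e2]
    exact ⟨u1_odd n p hn, fun _ => u1_second n p hn⟩
end

section
/- Let n and k be integers with k ≥ 2 and n ≥ 2^k, and let t be a positive integer. Then the U(1) system with parameters (n,k,t) has no nontrivial integer solution if and only if t < b(n,k) = (2^{⌊k/2⌋}/⌈k/2⌉!)·∏_{α=1}^{⌈k/2⌉}(n−k+2α−1). -/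
open Finset

/-- `E_j(x)`. -/
def uE (m j : ℕ) (x : ℕ → ℤ) : ℤ := ∑ i ∈ range (m + 1), (m.choose i : ℤ) * x (i + j)

/-- weighted L1 norm. -/
def uN (n : ℕ) (x : ℕ → ℤ) : ℤ := ∑ l ∈ range (n + 1), (n.choose l : ℤ) * |x l|

/-- one-sided vector. -/
def uW (d a : ℕ) (l : ℕ) : ℤ := if l ≤ a then (-1) ^ (a - l) * ((d + (a - l)).choose d : ℤ) else 0

/-- one-sided norm. -/
def uC (n d a : ℕ) : ℤ := ∑ p ∈ antidiagonal a, (n.choose p.1 : ℤ) * ((d + p.2).choose d : ℤ)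

lemma uE_eq (m j : ℕ) (x : ℕ → ℤ) :
    ∑ l ∈ Icc j (m + j), (m.choose (l - j) : ℤ) * x l = uE m j x := by
  unfold uE
  symm
  apply Finset.sum_bij (fun i _ => i + j)
  · intro i hi; simp at hi ⊢; omega
  · intro i _ i' _ h; omega
  · intro l hl; simp at hl; exact ⟨l - j, by simp; omega, by omega⟩
  · intro i _; simp

lemma uE_sub (m j : ℕ) (x y : ℕ → ℤ) : uE m j (fun l => x l - y l) = uE m j x - uE m j y := by
  unfold uE; rw [← Finset.sum_sub_distrib]; apply Finset.sum_congr rfl; intros; ring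

lemma uE_smul (m j : ℕ) (c : ℤ) (x : ℕ → ℤ) : uE m j (fun l => c * x l) = c * uE m j x := by
  unfold uE; rw [Finset.mul_sum]; apply Finset.sum_congr rfl; intros; ring

lemma uE_refl (m k j : ℕ) (hj : j ≤ k) (x : ℕ → ℤ) :
    uE m j (fun l => x (m + k - l)) = uE m (k - j) x := by
  unfold uE
  rw [← Finset.sum_range_reflect]
  apply Finset.sum_congr rfl
  intro i hi
  simp at hi
  have h1 : m + 1 - 1 - i = m - i := by omega
  have h2 : m + k - (m - i + j) = i + (k - j) := by omega
  simp only [h1, h2]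
  rw [Nat.choose_symm (by omega)]

lemma coeff_one_sub_pow (m i : ℕ) :
    PowerSeries.coeff i ((1 - PowerSeries.X : PowerSeries ℤ) ^ m) = (-1) ^ i * (m.choose i : ℤ) := by
  induction m generalizing i with
  | zero => cases i <;> simp [PowerSeries.coeff_one]
  | succ m ih =>
    rw [pow_succ, mul_sub, mul_one, map_sub, ih]
    cases i with
    | zero => simp
    | succ i => rw [PowerSeries.coeff_succ_mul_X, ih, Nat.choose_succ_succ]; push_cast; ring

lemma coeff_one_add_pow (m i : ℕ) :
    PowerSeries.coeff i ((1 + PowerSeries.X : PowerSeries ℤ) ^ m) = (m.choose i : ℤ) := by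
  induction m generalizing i with
  | zero => cases i <;> simp [PowerSeries.coeff_one]
  | succ m ih =>
    rw [pow_succ, mul_add, mul_one, map_add, ih]
    cases i with
    | zero => simp
    | succ i => rw [PowerSeries.coeff_succ_mul_X, ih, Nat.choose_succ_succ]; push_cast; ring

lemma uE_W (d a j : ℕ) : uE (d + 1) j (uW d a) = if j = a then 1 else 0 := by
  by_cases hj : j ≤ a
  · obtain ⟨r, rfl⟩ := Nat.exists_eq_add_of_le hj
    have key := congrArg (PowerSeries.coeff r)
      (PowerSeries.mk_add_choose_mul_one_sub_pow_eq_one ℤ d)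
    rw [mul_comm, PowerSeries.coeff_mul, PowerSeries.coeff_one,
      Finset.Nat.sum_antidiagonal_eq_sum_range_succ_mk] at key
    simp only [coeff_one_sub_pow, PowerSeries.coeff_mk] at key
    have h1 : uE (d + 1) j (uW d (j + r)) = (-1) ^ r * ∑ x ∈ range r.succ,
        (-1) ^ x * ((d + 1).choose x : ℤ) * ((d + (r - x)).choose d : ℤ) := by
      unfold uE
      rw [Finset.mul_sum]
      have e1 : ∀ N, r ≤ N → d + 1 ≤ N →
        ∑ i ∈ range (d + 1 + 1), ((d + 1).choose i : ℤ) * uW d (j + r) (i + j) =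
        ∑ i ∈ range (N + 1), ((d + 1).choose i : ℤ) * uW d (j + r) (i + j) := by
        intro N _ _
        apply Finset.sum_subset
        · intro i hi; simp at hi ⊢; omega
        · intro i _ hi; simp at hi
          rw [Nat.choose_eq_zero_of_lt (by omega)]; simp
      rw [e1 (r + d + 1) (by omega) (by omega)]
      symm
      apply Finset.sum_subset_zero_on_sdiff
      · intro i hi; simp at hi ⊢; omega
      · intro i hi; simp at hi; simp [uW, show ¬ (i + j ≤ j + r) by omega]
      · intro i hi
        simp at hi
        obtain ⟨s, rfl⟩ := Nat.exists_eq_add_of_le (show i ≤ r by omega)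
        have e2 : j + (i + s) - (i + j) = s := by omega
        have e3 : ((-1 : ℤ) ^ i) * (-1) ^ i = 1 := by rw [← mul_pow]; simp
        simp only [uW, e2, if_pos (show i + j ≤ j + (i + s) by omega), Nat.add_sub_cancel_left,
          pow_add]
        linear_combination ((-1) ^ s * ((d + 1).choose i : ℤ) * ((d + s).choose d : ℤ)) * e3
    rw [h1, key]
    by_cases hr : r = 0
    · simp [hr]
    · simp [hr]
  · unfold uE
    rw [if_neg (by omega)]
    apply Finset.sum_eq_zero
    intro i _
    simp [uW, show ¬ (i + j ≤ a) by omega]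

lemma uN_refl (n : ℕ) (x : ℕ → ℤ) : uN n (fun l => x (n - l)) = uN n x := by
  unfold uN
  rw [← Finset.sum_range_reflect]
  apply Finset.sum_congr rfl
  intro i hi
  simp at hi
  have h1 : n + 1 - 1 - i = n - i := by omega
  have h2 : n - (n - i) = i := by omega
  simp only [h1, h2]
  rw [Nat.choose_symm (by omega)]

lemma uN_W (n d a : ℕ) (ha : a ≤ n) : uN n (uW d a) = uC n d a := by
  unfold uN uC
  rw [Finset.Nat.sum_antidiagonal_eq_sum_range_succ_mk]
  symm
  apply Finset.sum_subset_zero_on_sdiff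
  · intro i hi; simp at hi ⊢; omega
  · intro i hi; simp at hi; simp [uW, show ¬ (i ≤ a) by omega]
  · intro i hi
    simp at hi
    simp [uW, show i ≤ a by omega, abs_mul]

lemma uN_smul (n : ℕ) (c : ℤ) (x : ℕ → ℤ) : uN n (fun l => c * x l) = |c| * uN n x := by
  unfold uN; rw [Finset.mul_sum]; apply Finset.sum_congr rfl; intros; rw [abs_mul]; ring

lemma uN_sub_le (n : ℕ) (x y : ℕ → ℤ) : uN n (fun l => x l - y l) ≤ uN n x + uN n y := by
  unfold uN; rw [← Finset.sum_add_distrib]; apply Finset.sum_le_sum; intro i _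
  rw [← mul_add]
  exact mul_le_mul_of_nonneg_left (abs_sub _ _) (by positivity)

lemma uN_le_sub (n : ℕ) (x y : ℕ → ℤ) : uN n x - uN n y ≤ uN n (fun l => x l - y l) := by
  unfold uN; rw [← Finset.sum_sub_distrib]; apply Finset.sum_le_sum; intro i _
  rw [← mul_sub]
  exact mul_le_mul_of_nonneg_left (abs_sub_abs_le_abs_sub _ _) (by positivity)

lemma uN_disj (n a : ℕ) (h : 2 * a < n) (f g : ℕ → ℤ) (hf : ∀ l, a < l → f l = 0)
    (hg : ∀ l, a < l → g l = 0) : uN n (fun l => f l - g (n - l)) = uN n f + uN n g := by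
  rw [← uN_refl n g]
  unfold uN; rw [← Finset.sum_add_distrib]; apply Finset.sum_congr rfl; intro i hi
  simp at hi
  by_cases h1 : a < i
  · simp [hf i h1]
  · simp [hg (n - i) (by omega)]

lemma uLeft (m k p q : ℕ) (hp : p + q = k + 1) (x : ℕ → ℤ)
    (hE : ∀ j ≤ k, uE m j x = 0) (hx : ∀ l, p ≤ l → l + q ≤ m + k → x l = 0) :
    ∀ l, l + q ≤ m + k → x l = 0 := by
  have key : ∀ i ≤ p, ∀ l, p - i ≤ l → l + q ≤ m + k → x l = 0 := by
    intro i
    induction i with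
    | zero => intro _ l h1 h2; exact hx l (by omega) h2
    | succ i ih =>
      intro hi l h1 h2
      by_cases h3 : p - i ≤ l
      · exact ih (by omega) l h3 h2
      · have h4 := hE l (by omega)
        unfold uE at h4
        rw [Finset.sum_range_succ', Finset.sum_eq_zero] at h4
        · simpa using h4
        · intro i' hi'
          simp at hi'
          rw [ih (by omega) _ (by omega) (by omega), mul_zero]
  intro l hl
  exact key p le_rfl l (by omega) hl

lemma uUniq (m k p q : ℕ) (hm : 0 < m) (hp : p + q = k + 1) (x : ℕ → ℤ)
    (hE : ∀ j ≤ k, uE m j x = 0) (hx : ∀ l, p ≤ l → l + q ≤ m + k → x l = 0) :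
    ∀ l ≤ m + k, x l = 0 := by
  intro l hl
  by_cases h : l + q ≤ m + k
  · exact uLeft m k p q hp x hE hx l h
  · have := uLeft m k q p (by omega) (fun l => x (m + k - l))
      (fun j hj => by rw [uE_refl m k j hj]; exact hE _ (by omega))
      (fun l h1 h2 => hx _ (by omega) (by omega)) (m + k - l) (by omega)
    rwa [show m + k - (m + k - l) = l by omega] at this

lemma uSum (m k : ℕ) (x : ℕ → ℤ) (hE : ∀ j ≤ k, uE m j x = 0) :
    ∑ l ∈ range (m + k + 1), ((m + k).choose l : ℤ) * x l = 0 := by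
  have h0 : ∑ j ∈ range (k + 1), (k.choose j : ℤ) * uE m j x = 0 := by
    apply Finset.sum_eq_zero; intro j hj; simp at hj; rw [hE j (by omega), mul_zero]
  rw [← h0]
  unfold uE
  simp_rw [Nat.add_choose_eq, Finset.mul_sum, Nat.cast_sum, Finset.sum_mul]
  rw [Finset.sum_sigma', ← Finset.sum_product']
  symm
  apply Finset.sum_of_injOn (fun p => ⟨p.2 + p.1, (p.2, p.1)⟩)
  · intro p _ p' _ h; simp at h; ext <;> simp [h]
  · intro p hp; simp at hp ⊢; omega
  · rintro ⟨l, i, j⟩ h1 h2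
    simp at h1 h2
    by_cases h3 : m < i
    · simp [Nat.choose_eq_zero_of_lt h3]
    · by_cases h4 : k < j
      · simp [Nat.choose_eq_zero_of_lt h4]
      · exfalso; have := h2 (by omega) (by omega); omega
  · rintro ⟨j, i⟩ _; push_cast; ring

lemma uMid_abs (m k c : ℕ) (x : ℕ → ℤ) (hE : ∀ j ≤ k, uE m j x = 0) (hc : c ≤ m + k)
    (hx : x c ≠ 0) : 2 * ((m + k).choose c : ℤ) ≤ uN (m + k) x := by
  have h := uSum m k x hE
  have hc' : c ∈ range (m + k + 1) := by simp; omega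
  unfold uN
  rw [← Finset.add_sum_erase _ _ hc'] at h ⊢
  have h1 : |∑ l ∈ (range (m + k + 1)).erase c, ((m + k).choose l : ℤ) * x l| ≤
      ∑ l ∈ (range (m + k + 1)).erase c, ((m + k).choose l : ℤ) * |x l| := by
    refine (Finset.abs_sum_le_sum_abs _ _).trans (le_of_eq ?_)
    apply Finset.sum_congr rfl; intro i _; rw [abs_mul]; simp
  rw [← neg_eq_of_add_eq_zero_right h, abs_neg, abs_mul, Nat.abs_cast] at h1
  have h2 : 1 ≤ |x c| := Int.one_le_abs hx
  have h3 : (0 : ℤ) ≤ ((m + k).choose c : ℤ) := by positivity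
  nlinarith

lemma choose_mid (n p c : ℕ) (h1 : p ≤ c) (h2 : c + p ≤ n) : n.choose p ≤ n.choose c := by
  have key : ∀ c, p ≤ c → 2 * c ≤ n → n.choose p ≤ n.choose c := by
    intro c hc
    induction c, hc using Nat.le_induction with
    | base => intro _; exact le_rfl
    | succ c hc ih =>
      intro h
      exact (ih (by omega)).trans (Nat.choose_le_succ_of_lt_half_left (by omega))
  by_cases h : 2 * c ≤ n
  · exact key c h1 h
  · rw [← Nat.choose_symm (show c ≤ n by omega)]
    exact key _ (by omega) (by omega)

/-- generating function. -/
noncomputable def uF (n d : ℕ) : PowerSeries ℤ :=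
  (1 + PowerSeries.X) ^ n * PowerSeries.mk (fun r => ((d + r).choose d : ℤ))

lemma uC_eq (n d a : ℕ) : uC n d a = PowerSeries.coeff a (uF n d) := by
  unfold uC uF
  rw [PowerSeries.coeff_mul]
  simp only [coeff_one_add_pow, PowerSeries.coeff_mk]

lemma uC_succ (n d a : ℕ) : uC (n + 1) d (a + 1) = uC n d (a + 1) + uC n d a := by
  simp only [uC_eq]
  have : uF (n + 1) d = uF n d + uF n d * PowerSeries.X := by unfold uF; ring
  rw [this, map_add, PowerSeries.coeff_succ_mul_X]

lemma uF_ode (n d : ℕ) : (1 - PowerSeries.X ^ 2) * PowerSeries.derivative ℤ (uF n d) =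
    ((n : PowerSeries ℤ) * (1 - PowerSeries.X) + ((d : PowerSeries ℤ) + 1) * (1 + PowerSeries.X))
      * uF n d := by
  set H : PowerSeries ℤ := PowerSeries.mk (fun r => ((d + r).choose d : ℤ)) with hH
  have h1 : (1 - PowerSeries.X) * PowerSeries.derivative ℤ H = ((d : PowerSeries ℤ) + 1) * H := by
    have hr : ∀ r : ℕ, ((d + (r + 1)).choose d : ℤ) * (r + 1) = (d + r + 1) * (d + r).choose d := by
      intro r
      have := Nat.add_one_mul_choose_eq (d + r) r
      have e1 : (d + (r + 1)).choose d = (d + r).succ.choose r.succ := by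
        rw [Nat.choose_symm_add]; rfl
      have e2 : (d + r).choose d = (d + r).choose r := Nat.choose_symm_add
      rw [e1, e2]
      have := congrArg (Nat.cast : ℕ → ℤ) this
      push_cast at this
      push_cast
      linarith
    ext r
    have e : ((d : PowerSeries ℤ) + 1) = PowerSeries.C ((d : ℤ) + 1) := by simp
    rw [sub_mul, one_mul, map_sub, PowerSeries.coeff_derivative, e, PowerSeries.coeff_C_mul, hH,
      PowerSeries.coeff_mk, PowerSeries.coeff_mk, hr]
    cases r with
    | zero => simp
    | succ r =>
      rw [PowerSeries.coeff_succ_X_mul, PowerSeries.coeff_derivative,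
        PowerSeries.coeff_mk]
      push_cast
      ring
  have h2 : (1 + PowerSeries.X) * PowerSeries.derivative ℤ ((1 + PowerSeries.X) ^ n)
      = (n : PowerSeries ℤ) * (1 + PowerSeries.X) ^ n := by
    rw [PowerSeries.derivative_pow]
    cases n with
    | zero => simp
    | succ n => simp; ring
  unfold uF
  rw [← hH, Derivation.leibniz, smul_eq_mul, smul_eq_mul]
  linear_combination ((1 + PowerSeries.X) ^ n * (1 + PowerSeries.X)) * h1 +
    (H * (1 - PowerSeries.X)) * h2

lemma uC_rec (n d r : ℕ) : ((r : ℤ) + 2) * uC n d (r + 2) =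
    ((n : ℤ) + d + 1) * uC n d (r + 1) + ((r : ℤ) - (n - d - 1)) * uC n d r := by
  simp only [uC_eq]
  have h := congrArg (PowerSeries.coeff (r + 1)) (uF_ode n d)
  have e : ((n : PowerSeries ℤ) * (1 - PowerSeries.X) +
      ((d : PowerSeries ℤ) + 1) * (1 + PowerSeries.X)) * uF n d
    = PowerSeries.C ((n : ℤ) + d + 1) * uF n d
      - PowerSeries.C ((n : ℤ) - d - 1) * (uF n d * PowerSeries.X) := by
    simp; ring
  have e' : (1 - PowerSeries.X ^ 2) * PowerSeries.derivative ℤ (uF n d) =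
    PowerSeries.derivative ℤ (uF n d) - PowerSeries.derivative ℤ (uF n d) * PowerSeries.X ^ 2 := by
    ring
  rw [e, e', map_sub, map_sub, PowerSeries.coeff_C_mul, PowerSeries.coeff_C_mul,
    PowerSeries.coeff_succ_mul_X, PowerSeries.coeff_derivative] at h
  have h3 : PowerSeries.coeff (r + 1) (PowerSeries.derivative ℤ (uF n d) * PowerSeries.X ^ 2)
      = r * PowerSeries.coeff r (uF n d) := by
    rw [pow_two, ← mul_assoc, PowerSeries.coeff_succ_mul_X]
    cases r with
    | zero => simp
    | succ r => rw [PowerSeries.coeff_succ_mul_X, PowerSeries.coeff_derivative]; push_cast; ring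
  rw [h3] at h
  push_cast at h
  linear_combination h

lemma uC_zero (n d : ℕ) : uC n d 0 = 1 := by simp [uC]

lemma uC_one (n d : ℕ) : uC n d 1 = n + d + 1 := by
  simp [uC, Finset.Nat.antidiagonal_succ]; ring

lemma uC_diag (d a : ℕ) : ((a : ℤ) + 1) * uC (d + 1 + 2 * (a + 1)) d (a + 1) =
    2 * (d + 1 + 2 * a + 1) * uC (d + 1 + 2 * a) d a := by
  have e : d + 1 + 2 * (a + 1) = (d + 1 + 2 * a) + 1 + 1 := by ring
  rw [e]
  cases a with
  | zero => simp [uC_zero, uC_one]; ring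
  | succ a =>
    rw [uC_succ, uC_succ, uC_succ]
    have := uC_rec (d + 1 + 2 * (a + 1)) d a
    push_cast at this ⊢
    linear_combination this

lemma uC_closed (d a : ℕ) : (uC (d + 1 + 2 * a) d a : ℚ) =
    2 ^ a / (a.factorial : ℚ) * ∏ α ∈ Icc 1 a, ((d : ℚ) + 1 + 2 * (α : ℚ) - 1) := by
  induction a with
  | zero => simp [uC_zero]
  | succ a ih =>
    have h := congrArg (Int.cast : ℤ → ℚ) (uC_diag d a)
    push_cast at h
    rw [ih] at h
    rw [Finset.prod_Icc_succ_top (by omega), Nat.factorial_succ]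
    have h1 : (a : ℚ) + 1 ≠ 0 := by positivity
    have h2 : (a.factorial : ℚ) ≠ 0 := by positivity
    rw [← mul_right_inj' h1, h]
    push_cast
    field_simp
    ring

lemma uB_even (d a : ℕ) : u1B (d + 1 + 2 * a) (2 * a) * 2 =
    ((uC (d + 1 + 2 * a) d a + uC (d + 1 + 2 * a) d a : ℤ) : ℚ) := by
  push_cast
  rw [uC_closed]
  unfold u1B
  rw [show 2 * a / 2 = a by omega, show (2 * a + 1) / 2 = a by omega]
  push_cast
  simp only [add_sub_cancel_right]
  ring

lemma uB_odd (d b : ℕ) : u1B (d + 1 + (2 * b + 1)) (2 * b + 1) * 2 =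
    ((uC (d + 1 + (2 * b + 1)) d (b + 1) + uC (d + 1 + (2 * b + 1)) d b : ℤ) : ℚ) := by
  rw [← uC_succ, show d + 1 + (2 * b + 1) + 1 = d + 1 + 2 * (b + 1) by ring, uC_closed]
  unfold u1B
  rw [show (2 * b + 1) / 2 = b by omega, show (2 * b + 1 + 1) / 2 = b + 1 by omega]
  push_cast
  simp only [add_sub_cancel_right]
  ring

lemma uC_closed_int (d a : ℕ) : (a.factorial : ℤ) * uC (d + 1 + 2 * a) d a =
    2 ^ a * ((∏ α ∈ Icc 1 a, (d + 2 * α) : ℕ) : ℤ) := by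
  have h := uC_closed d a
  have h2 : (a.factorial : ℚ) ≠ 0 := by positivity
  have h3 : ∏ α ∈ Icc 1 a, ((d : ℚ) + 1 + 2 * (α : ℚ) - 1) =
      ((∏ α ∈ Icc 1 a, (d + 2 * α) : ℕ) : ℚ) := by
    push_cast
    apply Finset.prod_congr rfl; intros; ring
  rw [h3] at h
  field_simp at h
  rw [mul_comm]
  exact_mod_cast h

lemma prod_le_desc (d a : ℕ) : ∏ α ∈ Icc 1 a, (d + 2 * α) ≤ (d + 2 * a).descFactorial a := by
  induction a with
  | zero => simp
  | succ a ih =>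
    rw [Finset.prod_Icc_succ_top (by omega), show d + 2 * (a + 1) = (d + 2 * a + 1) + 1 by ring,
      Nat.succ_descFactorial_succ, mul_comm]
    exact Nat.mul_le_mul_left _ (ih.trans (Nat.descFactorial_le _ (by omega)))

lemma mid_even (d a : ℕ) (h : 2 ^ (2 * a) ≤ d + 1 + 2 * a) :
    uC (d + 1 + 2 * a) d a ≤ ((d + 1 + 2 * a).choose (a + 1) : ℤ) := by
  have h1 := uC_closed_int d a
  have h2 := prod_le_desc d a
  have h3 := Nat.descFactorial_eq_factorial_mul_choose (d + 1 + 2 * a) (a + 1)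
  rw [show d + 1 + 2 * a = d + 2 * a + 1 by ring, Nat.succ_descFactorial_succ,
    show d + 2 * a + 1 = d + 1 + 2 * a by ring] at h3
  have h4 : (a + 1) * 2 ^ a ≤ d + 1 + 2 * a := by
    refine le_trans ?_ h
    rw [two_mul, pow_add]
    exact Nat.mul_le_mul_right _ Nat.lt_two_pow_self
  have h5 := Nat.mul_le_mul h4 h2
  rw [h3] at h5
  have h6 : (0 : ℤ) < ((a + 1).factorial : ℤ) := by positivity
  refine le_of_mul_le_mul_left ?_ h6
  zify at h5
  refine le_trans (le_of_eq ?_) h5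
  rw [Nat.factorial_succ]
  push_cast at h1 ⊢
  linear_combination ((a : ℤ) + 1) * h1

lemma odd_bounds (b n : ℕ) (hb : 1 ≤ b) (h : 2 ^ (2 * b + 1) ≤ n) :
    (b + 2) * 2 ^ b + (b + 1) ≤ n ∧ 4 * b + 4 ≤ n := by
  have h1 : b + 1 ≤ 2 ^ b := Nat.lt_two_pow_self
  rw [pow_succ, two_mul, pow_add] at h
  constructor <;> nlinarith

lemma mid_odd (d b : ℕ) (hb : 1 ≤ b) (h : 2 ^ (2 * b + 1) ≤ d + 1 + (2 * b + 1)) :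
    uC (d + 1 + (2 * b + 1)) d (b + 1) + uC (d + 1 + (2 * b + 1)) d b ≤
      2 * ((d + 1 + (2 * b + 1)).choose (b + 2) : ℤ) := by
  rw [← uC_succ, show d + 1 + (2 * b + 1) + 1 = d + 1 + 2 * (b + 1) by ring]
  have h0 := (odd_bounds b _ hb h).1
  have h1 := uC_closed_int d (b + 1)
  have h2 := prod_le_desc d (b + 1)
  rw [show d + 1 + (2 * b + 1) = d + 2 * (b + 1) by ring] at h0 ⊢
  have h3 := Nat.descFactorial_eq_factorial_mul_choose (d + 2 * (b + 1)) (b + 2)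
  rw [Nat.descFactorial_succ] at h3
  have h4 : (b + 2) * 2 ^ b ≤ d + 2 * (b + 1) - (b + 1) := by omega
  have h5 := Nat.mul_le_mul h4 h2
  rw [h3] at h5
  have h6 : (0 : ℤ) < ((b + 2).factorial : ℤ) := by positivity
  refine le_of_mul_le_mul_left ?_ h6
  have h7 : (((b + 2) * 2 ^ b * ∏ α ∈ Icc 1 (b + 1), (d + 2 * α) : ℕ) : ℤ) ≤
    (((b + 2).factorial * (d + 2 * (b + 1)).choose (b + 2) : ℕ) : ℤ) := by exact_mod_cast h5
  have h8 : ((b + 2).factorial : ℤ) * uC (d + 1 + 2 * (b + 1)) d (b + 1) =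
      2 * (((b + 2) * 2 ^ b * ∏ α ∈ Icc 1 (b + 1), (d + 2 * α) : ℕ) : ℤ) := by
    rw [Nat.factorial_succ]
    push_cast at h1 ⊢
    linear_combination ((b : ℤ) + 2) * h1
  rw [h8]
  push_cast at h7 ⊢
  linarith

lemma three_le (n d b : ℕ) (h : 2 * b + 2 ≤ d) : 3 * uC n d b ≤ uC n d (b + 1) := by
  unfold uC
  rw [Finset.Nat.sum_antidiagonal_succ', Finset.mul_sum]
  refine le_trans (Finset.sum_le_sum (fun p hp => ?_)) (le_add_of_nonneg_left (by positivity))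
  simp at hp
  have e1 := Nat.add_one_mul_choose_eq (d + p.2) p.2
  have e2 : (d + (p.2 + 1)).choose d = (d + p.2 + 1).choose (p.2 + 1) := by
    rw [Nat.choose_symm_add]; rfl
  have e3 : (d + p.2).choose d = (d + p.2).choose p.2 := Nat.choose_symm_add
  have e4 : 3 * (d + p.2).choose d ≤ (d + (p.2 + 1)).choose d := by
    rw [e2, e3]
    refine Nat.le_of_mul_le_mul_right (c := p.2 + 1) ?_ (by omega)
    rw [← e1]
    have : 3 * (p.2 + 1) ≤ d + p.2 + 1 := by omega
    nlinarith [Nat.zero_le ((d + p.2).choose p.2)]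
  zify at e4
  have := mul_le_mul_of_nonneg_left e4 (show (0 : ℤ) ≤ (n.choose p.1 : ℤ) by positivity)
  push_cast at this ⊢
  linarith

lemma uW_self (d a : ℕ) : uW d a a = 1 := by simp [uW]

lemma uW_gt (d a l : ℕ) (h : a < l) : uW d a l = 0 := by simp [uW, show ¬ l ≤ a by omega]

lemma uN_congr (n : ℕ) (x y : ℕ → ℤ) (h : ∀ l ≤ n, x l = y l) : uN n x = uN n y := by
  unfold uN; apply Finset.sum_congr rfl; intro l hl; simp at hl; rw [h l (by omega)]

lemma uC_pos (n d a : ℕ) : 0 ≤ uC n d a := by unfold uC; positivity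

lemma lower_even (d a : ℕ) (ha : 1 ≤ a) (h : 2 ^ (2 * a) ≤ d + 1 + 2 * a) (x : ℕ → ℤ)
    (hE : ∀ j ≤ 2 * a, uE (d + 1) j x = 0) (hx : ∃ l ≤ d + 1 + 2 * a, x l ≠ 0) :
    uC (d + 1 + 2 * a) d a + uC (d + 1 + 2 * a) d a ≤ uN (d + 1 + 2 * a) x := by
  by_cases hc : ∃ c, a + 1 ≤ c ∧ c + (a + 1) ≤ d + 1 + 2 * a ∧ x c ≠ 0
  · obtain ⟨c, h1, h2, h3⟩ := hc
    have e1 := uMid_abs (d + 1) (2 * a) c x hE (by omega) h3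
    have e2 := mid_even d a h
    have e3 : (((d + 1 + 2 * a).choose (a + 1) : ℕ) : ℤ) ≤ ((d + 1 + 2 * a).choose c : ℕ) := by
      exact_mod_cast choose_mid _ _ _ h1 h2
    linarith
  · push Not at hc
    have hlt : 2 * a < d + 1 + 2 * a := by omega
    set v : ℕ → ℤ := fun l => uW d a l - uW d a (d + 1 + 2 * a - l) with hv
    have hz := uUniq (d + 1) (2 * a) a (a + 1) (by omega) (by omega)
      (fun l => x l - x a * v l)
      (fun j hj => by
        rw [uE_sub, uE_smul, hE j hj, hv, uE_sub, uE_refl _ _ _ hj, uE_W, uE_W]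
        by_cases hja : j = a
        · simp [hja, show 2 * a - a = a by omega]
        · simp [hja, show ¬ 2 * a - j = a by omega])
      (fun l h1 h2 => by
        rcases Nat.eq_or_lt_of_le h1 with h3 | h3
        · subst h3
          simp [hv, uW_self, uW_gt d a (d + 1 + 2 * a - a) (by omega)]
        · simp [hc l h3 h2, hv, uW_gt d a l h3, uW_gt d a (d + 1 + 2 * a - l) (by omega)])
    have hxv : ∀ l ≤ d + 1 + 2 * a, x l = x a * v l := fun l hl => sub_eq_zero.mp (hz l hl)
    have hxa : x a ≠ 0 := by
      intro h0
      obtain ⟨l, hl, hne⟩ := hx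
      exact hne (by rw [hxv l hl, h0, zero_mul])
    rw [uN_congr _ _ _ hxv, uN_smul, hv, uN_disj _ a hlt _ _ (uW_gt d a) (uW_gt d a),
      uN_W _ _ _ (by omega)]
    have := Int.one_le_abs hxa
    nlinarith [uC_pos (d + 1 + 2 * a) d a]

lemma lower_odd (d b : ℕ) (hb : 1 ≤ b) (h : 2 ^ (2 * b + 1) ≤ d + 1 + (2 * b + 1)) (x : ℕ → ℤ)
    (hE : ∀ j ≤ 2 * b + 1, uE (d + 1) j x = 0) (hx : ∃ l ≤ d + 1 + (2 * b + 1), x l ≠ 0) :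
    uC (d + 1 + (2 * b + 1)) d (b + 1) + uC (d + 1 + (2 * b + 1)) d b ≤
      uN (d + 1 + (2 * b + 1)) x := by
  by_cases hc : ∃ c, b + 2 ≤ c ∧ c + (b + 2) ≤ d + 1 + (2 * b + 1) ∧ x c ≠ 0
  · obtain ⟨c, h1, h2, h3⟩ := hc
    have e1 := uMid_abs (d + 1) (2 * b + 1) c x hE (by omega) h3
    have e2 := mid_odd d b hb h
    have e3 : (((d + 1 + (2 * b + 1)).choose (b + 2) : ℕ) : ℤ) ≤
        ((d + 1 + (2 * b + 1)).choose c : ℕ) := by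
      exact_mod_cast choose_mid _ _ _ h1 h2
    linarith
  · push Not at hc
    have h4 := (odd_bounds b _ hb h).2
    have h3 := three_le (d + 1 + (2 * b + 1)) d b (by omega)
    obtain ⟨n, hn⟩ : ∃ n, n = d + 1 + (2 * b + 1) := ⟨_, rfl⟩
    obtain ⟨c, hcc⟩ : ∃ c, c = x (b + 1) := ⟨_, rfl⟩
    obtain ⟨c', hcc'⟩ : ∃ c', c' = x (n - (b + 1)) := ⟨_, rfl⟩
    set f : ℕ → ℤ := fun l => c * uW d (b + 1) l - c' * uW d b l with hf
    set g : ℕ → ℤ := fun l => c * uW d b l - c' * uW d (b + 1) l with hg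
    have hf0 : ∀ l, b + 1 < l → f l = 0 := fun l hl => by
      simp [hf, uW_gt d (b + 1) l hl, uW_gt d b l (by omega)]
    have hg0 : ∀ l, b + 1 < l → g l = 0 := fun l hl => by
      simp [hg, uW_gt d (b + 1) l hl, uW_gt d b l (by omega)]
    have hfb : f (b + 1) = c := by simp [hf, uW_self, uW_gt d b (b + 1) (by omega)]
    have hgb : g (b + 1) = - c' := by simp [hg, uW_self, uW_gt d b (b + 1) (by omega)]
    have hz := uUniq (d + 1) (2 * b + 1) (b + 1) (b + 1) (by omega) (by omega)
      (fun l => x l - (f l - g (d + 1 + (2 * b + 1) - l)))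
      (fun j hj => by
        rw [uE_sub, uE_sub, hE j hj, uE_refl _ _ _ hj, hf, hg, uE_sub, uE_sub, uE_smul, uE_smul,
          uE_smul, uE_smul, uE_W, uE_W, uE_W, uE_W]
        by_cases hja : j = b + 1
        · simp [hja, show 2 * b + 1 - (b + 1) = b by omega]
        · by_cases hjb : j = b
          · simp [hjb, show 2 * b + 1 - b = b + 1 by omega]
          · simp [hja, hjb, show ¬ 2 * b + 1 - j = b by omega,
              show ¬ 2 * b + 1 - j = b + 1 by omega])
      (fun l h1 h2 => by
        rw [← hn] at h2 h4 hc ⊢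
        rcases Nat.eq_or_lt_of_le h1 with h3 | h3
        · subst h3
          simp [hfb, hg0 (n - (b + 1)) (by omega), hcc]
        · rcases Nat.eq_or_lt_of_le h2 with h5 | h5
          · have h6 : l = n - (b + 1) := by omega
            have h7 : n - (n - (b + 1)) = b + 1 := by omega
            rw [h6, h7, hgb, hf0 _ (by omega), hcc']; ring
          · rw [hc l h3 (by omega), hf0 _ h3, hg0 _ (by omega)]; ring)
    rw [← hn] at hz h3 h4 hx ⊢
    have hxv : ∀ l ≤ n, x l = f l - g (n - l) := fun l hl => sub_eq_zero.mp (hz l hl)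
    rw [uN_congr _ _ _ hxv, uN_disj _ (b + 1) (by omega) _ _ hf0 hg0]
    have hb1 : uN n (uW d (b + 1)) = uC n d (b + 1) := uN_W _ _ _ (by omega)
    have hb2 : uN n (uW d b) = uC n d b := uN_W _ _ _ (by omega)
    have p1 := uC_pos n d b
    by_cases h0 : c = 0
    · by_cases h0' : c' = 0
      · exfalso
        obtain ⟨l, hl, hne⟩ := hx
        exact hne (by rw [hxv l hl]; simp [hf, hg, h0, h0'])
      · have e1 : f = fun l => (-c') * uW d b l := by ext l; simp [hf, h0]
        have e2 : g = fun l => (-c') * uW d (b + 1) l := by ext l; simp [hg, h0]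
        rw [e1, e2, uN_smul, uN_smul, hb1, hb2, abs_neg]
        have := Int.one_le_abs h0'
        nlinarith
    · by_cases h0' : c' = 0
      · have e1 : f = fun l => c * uW d (b + 1) l := by ext l; simp [hf, h0']
        have e2 : g = fun l => c * uW d b l := by ext l; simp [hg, h0']
        rw [e1, e2, uN_smul, uN_smul, hb1, hb2]
        have := Int.one_le_abs h0
        nlinarith
      · have q1 := uN_le_sub n (fun l => c * uW d (b + 1) l) (fun l => c' * uW d b l)
        have q2 := uN_le_sub n (fun l => c' * uW d (b + 1) l) (fun l => c * uW d b l)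
        have q3 : uN n g = uN n (fun l => c' * uW d (b + 1) l - c * uW d b l) := by
          unfold uN
          apply Finset.sum_congr rfl; intro l _; simp only [hg]; rw [abs_sub_comm]
        rw [q3]
        rw [uN_smul, uN_smul, hb1, hb2] at q1 q2
        have r1 := Int.one_le_abs h0
        have r2 := Int.one_le_abs h0'
        have s1 := mul_le_mul_of_nonneg_right r1 (show 0 ≤ uC n d (b + 1) - uC n d b by linarith)
        have s2 := mul_le_mul_of_nonneg_right r2 (show 0 ≤ uC n d (b + 1) - uC n d b by linarith)
        nlinarith

lemma upper (d a b : ℕ) : ∃ x : ℕ → ℤ, (∃ l ≤ d + 1 + (a + b), x l ≠ 0) ∧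
    (∀ j ≤ a + b, uE (d + 1) j x = 0) ∧
    uN (d + 1 + (a + b)) x ≤ uC (d + 1 + (a + b)) d a + uC (d + 1 + (a + b)) d b := by
  refine ⟨fun l => uW d a l - uW d b (d + 1 + (a + b) - l), ⟨a, by omega, ?_⟩, ?_, ?_⟩
  · simp [uW_self, uW_gt d b (d + 1 + (a + b) - a) (by omega)]
  · intro j hj
    rw [uE_sub, uE_refl _ _ _ hj, uE_W, uE_W]
    by_cases h : j = a
    · simp [h]
    · simp [h, show ¬ a + b - j = b by omega]
  · refine (uN_sub_le _ _ _).trans ?_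
    rw [uN_refl, uN_W _ _ _ (by omega), uN_W _ _ _ (by omega)]

/-- Theorem (U(1), general locality, n ≥ 2^k). -/
theorem U1_general_locality (n k t : ℕ) (hk : 2 ≤ k) (hn : 2 ^ k ≤ n) (ht : 0 < t) :
    (¬ ∃ x : ℕ → ℤ, U1Nontrivial n x ∧ U1System n k t x) ↔ (t : ℚ) < u1B n k := by
  have hkn : k < n := lt_of_lt_of_le Nat.lt_two_pow_self hn
  obtain ⟨d, rfl⟩ : ∃ d, n = d + 1 + k := ⟨n - k - 1, by omega⟩
  have hsys : ∀ x, U1Nontrivial (d + 1 + k) x ∧ U1System (d + 1 + k) k t x ↔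
      (∃ l ≤ d + 1 + k, x l ≠ 0) ∧ (∀ j ≤ k, uE (d + 1) j x = 0) ∧
        uN (d + 1 + k) x ≤ 2 * (t : ℤ) := by
    intro x
    unfold U1Nontrivial U1System uN
    simp only [Nat.add_sub_cancel, uE_eq, Finset.mem_range, Nat.lt_succ_iff]
    tauto
  simp only [hsys]
  have fin : ∀ a b : ℕ, a + b = k →
      u1B (d + 1 + k) k * 2 = ((uC (d + 1 + k) d a + uC (d + 1 + k) d b : ℤ) : ℚ) →
      (∀ x : ℕ → ℤ, (∀ j ≤ k, uE (d + 1) j x = 0) → (∃ l ≤ d + 1 + k, x l ≠ 0) →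
        uC (d + 1 + k) d a + uC (d + 1 + k) d b ≤ uN (d + 1 + k) x) →
      ((¬ ∃ x : ℕ → ℤ, (∃ l ≤ d + 1 + k, x l ≠ 0) ∧ (∀ j ≤ k, uE (d + 1) j x = 0) ∧
        uN (d + 1 + k) x ≤ 2 * (t : ℤ)) ↔ (t : ℚ) < u1B (d + 1 + k) k) := by
    intro a b hab hB hlow
    have e : (t : ℚ) < u1B (d + 1 + k) k ↔
        2 * (t : ℤ) < uC (d + 1 + k) d a + uC (d + 1 + k) d b := by
      rw [← @Int.cast_lt ℚ, ← hB]
      push_cast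
      constructor <;> intro <;> linarith
    rw [e]
    constructor
    · intro hno
      by_contra hlt
      obtain ⟨x, h1, h2, h3⟩ := upper d a b
      rw [hab] at h1 h2 h3
      exact hno ⟨x, h1, h2, by linarith⟩
    · rintro hlt ⟨x, h1, h2, h3⟩
      have := hlow x h2 h1
      linarith
  rcases Nat.even_or_odd' k with ⟨a, rfl | rfl⟩
  · exact fin a a (by omega) (uB_even d a) (fun x h1 h2 => lower_even d a (by omega) hn x h1 h2)
  · exact fin (a + 1) a (by omega) (uB_odd d a)
      (fun x h1 h2 => lower_odd d a (by omega) hn x h1 h2)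
end

section
/- Let n ≥ 3 and t ≥ 1 be integers. The U(1) system with parameters (n,2,t) has no nontrivial integer solution if and only if t < 2(n−1). -/
theorem u1_choose_ge_two (n j : ℕ) (h1 : 1 ≤ j) (h2 : j ≤ n) : 2 ≤ (n + 1).choose j := by
  obtain ⟨i, rfl⟩ : ∃ i, j = i + 1 := ⟨j - 1, by omega⟩
  rw [Nat.choose_succ_succ]
  have a := Nat.choose_pos (n := n) (k := i) (by omega)
  have b := Nat.choose_pos (n := n) (k := i + 1) h2
  simp only [Nat.succ_eq_add_one]
  omega

theorem u1_choose_ge (m l : ℕ) (h1 : 2 ≤ l) (h2 : l ≤ m) : 2 * (m + 1) ≤ (m + 2).choose l := by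
  induction m generalizing l with
  | zero => omega
  | succ m ih =>
    obtain ⟨i, rfl⟩ : ∃ i, l = i + 1 := ⟨l - 1, by omega⟩
    have e : (m + 1 + 2).choose (i + 1) = (m + 2).choose i + (m + 2).choose (i + 1) :=
      Nat.choose_succ_succ (m + 2) i
    rw [e]
    by_cases h : i + 1 ≤ m
    · have a := ih (i + 1) h1 h
      have b := u1_choose_ge_two (m + 1) i (by omega) (by omega)
      have e2 : m + 1 + 1 = m + 2 := rfl
      rw [e2] at b
      omega
    · have hi : i = m := by omega
      subst hi
      have b := u1_choose_ge_two (i + 1) (i + 1) (by omega) (by omega)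
      have e2 : i + 1 + 1 = i + 2 := rfl
      rw [e2] at b
      by_cases hh : 2 ≤ i
      · have a := ih i hh le_rfl
        omega
      · have : i = 1 := by omega
        subst this
        decide

theorem u1_pascal (m : ℕ) (f : ℕ → ℤ) :
    ∑ l ∈ Finset.range (m + 2), ((m + 1).choose l : ℤ) * f l
      = ∑ l ∈ Finset.range (m + 1), (m.choose l : ℤ) * f l
        + ∑ l ∈ Finset.range (m + 1), (m.choose l : ℤ) * f (l + 1) := by
  have := Finset.sum_choose_succ_mul (R := ℤ) (fun i _ => f i) m
  simpa [add_comm] using this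

theorem u1_pascal_two (m : ℕ) (f : ℕ → ℤ) :
    ∑ l ∈ Finset.range (m + 3), ((m + 2).choose l : ℤ) * f l
      = ∑ l ∈ Finset.range (m + 1), (m.choose l : ℤ) * f l
        + 2 * ∑ l ∈ Finset.range (m + 1), (m.choose l : ℤ) * f (l + 1)
        + ∑ l ∈ Finset.range (m + 1), (m.choose l : ℤ) * f (l + 2) := by
  have h := u1_pascal (m + 1) f
  rw [u1_pascal m f, u1_pascal m (fun l => f (l + 1))] at h
  refine h.trans ?_
  ring

theorem u1_shift (m j : ℕ) (x : ℕ → ℤ) :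
    ∑ l ∈ Finset.Icc j (m + j), (m.choose (l - j) : ℤ) * x l
      = ∑ i ∈ Finset.range (m + 1), (m.choose i : ℤ) * x (i + j) := by
  symm
  apply Finset.sum_bij (fun i _ => i + j)
  · intro a ha; simp at ha ⊢; omega
  · intro a _ b _ h; simpa using h
  · intro b hb
    simp at hb
    exact ⟨b - j, by simp; omega, by omega⟩
  · intro a _; simp

/-- Under vanishing interior, the three equations become explicit. -/
theorem u1_eqs (m : ℕ) (hm : 1 ≤ m) (x : ℕ → ℤ) (hx : ∀ l, 2 ≤ l → l ≤ m → x l = 0) :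
    (∑ i ∈ Finset.range (m + 1), (m.choose i : ℤ) * x i = x 0 + m * x 1) ∧
    (∑ i ∈ Finset.range (m + 1), (m.choose i : ℤ) * x (i + 1) = x 1 + x (m + 1)) ∧
    (∑ i ∈ Finset.range (m + 1), (m.choose i : ℤ) * x (i + 2) = m * x (m + 1) + x (m + 2)) := by
  refine ⟨?_, ?_, ?_⟩
  · rw [← Finset.sum_subset (s₁ := {0, 1})]
    · rw [Finset.sum_pair (by omega)]; simp
    · intro a; simp; omega
    · intro a ha hb
      simp at ha hb
      rw [hx a (by omega) (by omega), mul_zero]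
  · rw [← Finset.sum_subset (s₁ := {0, m})]
    · rw [Finset.sum_pair (by omega)]; simp
    · intro a; simp; omega
    · intro a ha hb
      simp at ha hb
      rw [hx (a + 1) (by omega) (by omega), mul_zero]
  · obtain ⟨p, rfl⟩ : ∃ p, m = p + 1 := ⟨m - 1, by omega⟩
    rw [← Finset.sum_subset (s₁ := {p, p + 1})]
    · rw [Finset.sum_pair (by omega)]; simp
    · intro a; simp; omega
    · intro a ha hb
      simp at ha hb
      rw [hx (a + 2) (by omega) (by omega), mul_zero]

theorem u1_norm (m : ℕ) (hm : 1 ≤ m) (x : ℕ → ℤ) (hx : ∀ l, 2 ≤ l → l ≤ m → x l = 0) :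
    ∑ l ∈ Finset.range (m + 3), ((m + 2).choose l : ℤ) * |x l|
      = |x 0| + (m + 2) * |x 1| + (m + 2) * |x (m + 1)| + |x (m + 2)| := by
  have h := u1_eqs m hm (fun l => |x l|) (fun l a b => by simp [hx l a b])
  rw [u1_pascal_two m (fun l => |x l|)]
  obtain ⟨a, b, c⟩ := h
  rw [a, b, c]
  ring

theorem u1_system_iff (m t : ℕ) (x : ℕ → ℤ) : U1System (m + 2) 2 t x ↔
    (∑ l ∈ Finset.range (m + 3), ((m + 2).choose l : ℤ) * |x l| ≤ 2 * (t : ℤ)) ∧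
    (∑ i ∈ Finset.range (m + 1), (m.choose i : ℤ) * x i = 0) ∧
    (∑ i ∈ Finset.range (m + 1), (m.choose i : ℤ) * x (i + 1) = 0) ∧
    (∑ i ∈ Finset.range (m + 1), (m.choose i : ℤ) * x (i + 2) = 0) := by
  unfold U1System
  simp only [Nat.add_sub_cancel, u1_shift]
  refine and_congr Iff.rfl ⟨fun h => ⟨?_, ?_, ?_⟩, fun h j hj => ?_⟩
  · simpa using h 0 (by simp)
  · simpa using h 1 (by simp)
  · simpa using h 2 (by simp)
  · simp at hj
    obtain ⟨a, b, c⟩ := h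
    interval_cases j
    · simpa using a
    · exact b
    · exact c

theorem U1_locality_two (n t : ℕ) (hn : 3 ≤ n) (ht : 0 < t) :
    (¬ ∃ x : ℕ → ℤ, U1Nontrivial n x ∧ U1System n 2 t x) ↔
      (t : ℤ) < 2 * ((n : ℤ) - 1) := by
  obtain ⟨m, rfl⟩ : ∃ m, n = m + 2 := ⟨n - 2, by omega⟩
  have hm : 1 ≤ m := by omega
  constructor
  · intro h
    by_contra hlt
    apply h
    let x : ℕ → ℤ := fun l => if l = 0 then m else if l = 1 then -1 else
      if l = m + 1 then 1 else if l = m + 2 then -m else 0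
    have x0 : x 0 = m := by simp [x]
    have x1 : x 1 = -1 := by simp [x]
    have x2 : x (m + 1) = 1 := by
      have : m ≠ 0 := by omega
      simp [x, this]
    have x3 : x (m + 2) = -m := by simp [x]
    have hx : ∀ l, 2 ≤ l → l ≤ m → x l = 0 := by
      intro l a b
      simp only [x]
      rw [if_neg (by omega), if_neg (by omega), if_neg (by omega), if_neg (by omega)]
    refine ⟨x, ⟨1, by simp, by rw [x1]; norm_num⟩, ?_⟩
    rw [u1_system_iff, u1_norm m hm x hx]
    obtain ⟨a, b, c⟩ := u1_eqs m hm x hx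
    rw [a, b, c, x0, x1, x2, x3]
    refine ⟨?_, by ring, by ring, by ring⟩
    simp only [abs_neg, abs_one, Nat.abs_cast]
    push_cast at hlt
    rw [not_lt] at hlt
    linarith
  · rintro hlt ⟨x, ⟨l0, hl0, hne⟩, hs⟩
    rw [u1_system_iff] at hs
    obtain ⟨hA, h0, h1, h2⟩ := hs
    push_cast at hlt
    have hsum := u1_pascal_two m x
    rw [h0, h1, h2] at hsum
    have hx : ∀ l, 2 ≤ l → l ≤ m → x l = 0 := by
      intro l a b
      by_contra hl
      have hmem : l ∈ Finset.range (m + 3) := by simp; omega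
      rw [← Finset.add_sum_erase _ _ hmem] at hsum hA
      have hc := u1_choose_ge m l a b
      have hc' : (2 * ((m : ℤ) + 1)) ≤ ((m + 2).choose l : ℤ) := by exact_mod_cast hc
      have habs : 1 ≤ |x l| := Int.one_le_abs hl
      have h3 := Finset.abs_sum_le_sum_abs (fun l => ((m + 2).choose l : ℤ) * x l)
        ((Finset.range (m + 3)).erase l)
      simp only [abs_mul, Nat.abs_cast] at h3
      have h4 : ∑ x_1 ∈ (Finset.range (m + 3)).erase l, ((m + 2).choose x_1 : ℤ) * x x_1
          = -(((m + 2).choose l : ℤ) * x l) := by linarith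
      rw [h4, abs_neg, abs_mul, Nat.abs_cast] at h3
      nlinarith
    rw [u1_norm m hm x hx] at hA
    obtain ⟨a, b, c⟩ := u1_eqs m hm x hx
    rw [a] at h0
    rw [b] at h1
    rw [c] at h2
    have e2 : x (m + 1) = - x 1 := by linarith
    have e0 : x 0 = -(m * x 1) := by linarith
    have e3 : x (m + 2) = m * x 1 := by rw [e2] at h2; linarith
    rw [e0, e2, e3] at hA
    simp only [abs_neg, abs_mul, Nat.abs_cast] at hA
    have hx1 : x 1 ≠ 0 := by
      intro hz
      rw [hz] at e0 e2 e3
      simp at e0 e2 e3 hl0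
      apply hne
      rcases (by omega : l0 = 0 ∨ l0 = 1 ∨ (2 ≤ l0 ∧ l0 ≤ m) ∨ l0 = m + 1 ∨ l0 = m + 2) with
        h | h | h | h | h
      · rw [h, e0]
      · rw [h, hz]
      · exact hx l0 h.1 h.2
      · rw [h, e2]
      · rw [h, e3]
    have habs : 1 ≤ |x 1| := Int.one_le_abs hx1
    nlinarith
end

section
/- Let n and k be integers with k ≥ 2 and n ≥ 2(⌊k/2⌋+1), and let t be a positive integer with t ≥ c(n,k). Then the SU(2) system with parameters (n,k,t) has a nontrivial integer solution. Explicitly, the vector y with y_j := (−1)^j·C(n − ⌊k/2⌋ − 1 − j, ⌊k/2⌋ + 1 − j) for j = 0,…,⌊n/2⌋ (so y_j = 0 for j > ⌊k/2⌋+1) is such a solution. -/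
/-- Extended binomial coefficient for integer arguments: `0` unless `0 ≤ r ≤ m`. -/
def zChoose (m r : ℤ) : ℤ :=
  if 0 ≤ r ∧ r ≤ m then (m.toNat.choose r.toNat : ℤ) else 0

/-- The quantity `c(n,k) = (2^⌊k/2⌋/(⌊k/2⌋+1)!)·∏_{α=1}^{⌊k/2⌋+1}(n−2α+1)`. -/
def su2C (n k : ℕ) : ℚ :=
  (2 ^ (k / 2) / (Nat.factorial (k / 2 + 1) : ℚ)) *
    ∏ α ∈ Finset.Icc 1 (k / 2 + 1), ((n : ℚ) - 2 * (α : ℚ) + 1)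

/-- The SU(2) system with parameters `(n,k,t)` on `x = (x_0,…,x_{⌊n/2⌋})`. -/
def SU2System (n k t : ℕ) (x : ℕ → ℤ) : Prop :=
  (∑ j ∈ Finset.range (n / 2 + 1),
      (zChoose (n : ℤ) (j : ℤ) - zChoose (n : ℤ) ((j : ℤ) - 1)) * |x j| ≤ 2 * (t : ℤ)) ∧
  ∀ l ∈ Finset.range (k / 2 + 1),
    ∑ j ∈ Finset.range (n / 2 + 1),
      (zChoose ((n : ℤ) - 2 * (l : ℤ)) ((j : ℤ) - (l : ℤ)) -
        zChoose ((n : ℤ) - 2 * (l : ℤ)) ((j : ℤ) - (l : ℤ) - 1)) * x j = 0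

/-- A vector `x = (x_0,…,x_{⌊n/2⌋})` is nontrivial if some coordinate is nonzero. -/
def SU2Nontrivial (n : ℕ) (x : ℕ → ℤ) : Prop :=
  ∃ j ∈ Finset.range (n / 2 + 1), x j ≠ 0

open PowerSeries in
theorem su2_Q_mul : (mk 1 : ℤ⟦X⟧) * (1 - X) = 1 := mk_one_mul_one_sub_eq_one ℤ

open PowerSeries in
theorem su2_dQ : d⁄dX ℤ (mk 1 : ℤ⟦X⟧) = (mk 1 : ℤ⟦X⟧) ^ 2 := by
  have h := su2_Q_mul
  have h2 : d⁄dX ℤ ((mk 1 : ℤ⟦X⟧) * (1 - X)) = 0 := by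
    rw [h]; exact derivative_one
  rw [Derivation.leibniz, map_sub, derivative_one, derivative_X] at h2
  simp only [smul_eq_mul] at h2
  generalize (mk 1 : ℤ⟦X⟧) = Q at *
  linear_combination Q * h2 - (d⁄dX ℤ Q) * h

open PowerSeries in
theorem su2_G_rec (M a : ℕ) :
    ((M : ℤ) + 1) * coeff (M + 1) ((1 + X : ℤ⟦X⟧) ^ (2 * (M + 1) + a) * (mk 1) ^ a) =
      2 * ((a : ℤ) + 1) * coeff M ((1 + X : ℤ⟦X⟧) ^ (2 * M + (a + 2)) * (mk 1) ^ (a + 2)) := by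
  have hQ := su2_Q_mul
  have hd := su2_dQ
  generalize (mk 1 : ℤ⟦X⟧) = Q at *
  have hP : d⁄dX ℤ (1 + X : ℤ⟦X⟧) = 1 := by
    rw [map_add, derivative_one, derivative_X, zero_add]
  have hN : d⁄dX ℤ ((1 + X : ℤ⟦X⟧) ^ (2 * M + a + 1 + 1)) =
      (((2 * M + a + 1 : ℕ) : ℤ⟦X⟧) + 1) * (1 + X) ^ (2 * M + a + 1) := by
    rw [derivative_pow, hP]; simp
  have hQa : ∀ b : ℕ, d⁄dX ℤ (Q ^ b) = (b : ℤ⟦X⟧) * Q ^ (b + 1) := by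
    intro b
    rw [derivative_pow, hd]
    cases b with
    | zero => simp
    | succ b => simp only [Nat.add_sub_cancel]; ring
  have e1 : 2 * (M + 1) + a = 2 * M + a + 1 + 1 := by ring
  have e2 : 2 * M + (a + 2) = 2 * M + a + 1 + 1 := by ring
  rw [e1, e2]
  have key : d⁄dX ℤ ((1 + X : ℤ⟦X⟧) ^ (2 * M + a + 1 + 1) * Q ^ a)
      + 2 * (X * d⁄dX ℤ ((1 + X : ℤ⟦X⟧) ^ (2 * M + a + 1 + 1) * Q ^ (a + 1))
        - C (M : ℤ) * ((1 + X : ℤ⟦X⟧) ^ (2 * M + a + 1 + 1) * Q ^ (a + 1)))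
      = C (2 * ((a : ℤ) + 1)) * ((1 + X : ℤ⟦X⟧) ^ (2 * M + a + 1 + 1) * Q ^ (a + 2)) := by
    rw [Derivation.leibniz, Derivation.leibniz, hN, hQa, hQa]
    simp only [smul_eq_mul, map_mul, map_add, map_natCast, map_one, map_ofNat]
    push_cast
    have hR : (1 + X : ℤ⟦X⟧) ^ (2 * M + a + 1 + 1) = (1 + X) ^ (2 * M + a + 1) * (1 + X) :=
      pow_succ _ _
    have q1 : Q ^ (a + 1) = Q ^ (a + 2) * (1 - X) := by
      linear_combination (-Q ^ (a + 1)) * hQ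
    have q0 : Q ^ a = Q ^ (a + 2) * (1 - X) ^ 2 := by
      linear_combination (-Q ^ a * (Q * (1 - X) + 1)) * hQ
    have q2 : Q ^ (a + 1 + 1) = Q ^ (a + 2) := rfl
    rw [q2, hR, q1, q0]
    ring
  have kc := congrArg (coeff M) key
  simp only [map_add, coeff_C_mul, coeff_derivative] at kc
  have two : ∀ f : ℤ⟦X⟧, coeff M (2 * f) = 2 * coeff M f := by
    intro f
    have : (2 : ℤ⟦X⟧) = C (2 : ℤ) := by simp
    rw [this, coeff_C_mul]
  have xd : ∀ f : ℤ⟦X⟧, coeff M (X * d⁄dX ℤ f) = M * coeff M f := by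
    intro f
    cases M with
    | zero => simp
    | succ M => rw [coeff_succ_X_mul, coeff_derivative]; push_cast; ring
  rw [two, map_sub, xd, coeff_C_mul] at kc
  linear_combination kc

open PowerSeries in
theorem su2_G_closed (M a : ℕ) :
    (M.factorial : ℤ) * coeff M ((1 + X : ℤ⟦X⟧) ^ (2 * M + a) * (mk 1) ^ a) =
      2 ^ M * ∏ i ∈ Finset.range M, ((a : ℤ) + 1 + 2 * i) := by
  induction M generalizing a with
  | zero => simp
  | succ M ih =>
    have h1 := su2_G_rec M a
    have h2 := ih (a + 2)
    rw [Finset.prod_range_succ', Nat.factorial_succ]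
    have h3 : ∏ i ∈ Finset.range M, ((a : ℤ) + 1 + 2 * ((i + 1 : ℕ) : ℤ)) =
        ∏ i ∈ Finset.range M, (((a + 2 : ℕ) : ℤ) + 1 + 2 * i) := by
      apply Finset.prod_congr rfl
      intro i _
      push_cast; ring
    rw [h3]
    push_cast at *
    linear_combination (M.factorial : ℤ) * h1 + 2 * ((a : ℤ) + 1) * h2

theorem su2_zChoose_nat (m r : ℕ) : zChoose (m : ℤ) (r : ℤ) = (m.choose r : ℤ) := by
  unfold zChoose
  split_ifs with h
  · simp
  · rw [Nat.choose_eq_zero_of_lt (by omega)]; simp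

theorem su2_zChoose_neg (m r : ℤ) (h : r < 0) : zChoose m r = 0 := by
  unfold zChoose
  rw [if_neg (by omega)]

open PowerSeries in
theorem su2_coeff_pow (N i : ℕ) : coeff i ((1 + X : ℤ⟦X⟧) ^ N) = (N.choose i : ℤ) := by
  have : ((1 + X : ℤ⟦X⟧) ^ N) = (((1 + Polynomial.X) ^ N : Polynomial ℤ) : ℤ⟦X⟧) := by simp
  rw [this, Polynomial.coeff_coe, Polynomial.coeff_one_add_X_pow]

open PowerSeries in
theorem su2_coeff_f (N i : ℕ) : coeff i ((1 - X) * (1 + X : ℤ⟦X⟧) ^ N) =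
    zChoose (N : ℤ) (i : ℤ) - zChoose (N : ℤ) ((i : ℤ) - 1) := by
  rw [sub_mul, one_mul, map_sub, su2_coeff_pow, su2_zChoose_nat]
  cases i with
  | zero => rw [su2_zChoose_neg _ _ (by simp)]; simp
  | succ i =>
    rw [coeff_succ_X_mul, su2_coeff_pow]
    have : (((i + 1 : ℕ) : ℤ) - 1) = (i : ℤ) := by push_cast; ring
    rw [this, su2_zChoose_nat]

open PowerSeries in
theorem su2_coeff_f_neg (N i : ℕ) : coeff i ((1 + X) * (1 - X : ℤ⟦X⟧) ^ N) =
    (-1) ^ i * (zChoose (N : ℤ) (i : ℤ) - zChoose (N : ℤ) ((i : ℤ) - 1)) := by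
  rw [← su2_coeff_f, ← coeff_rescale]
  congr 1
  simp [rescale_X, sub_eq_add_neg]

open PowerSeries in
theorem su2_coeff_Q (a i : ℕ) : coeff i ((mk 1 : ℤ⟦X⟧) ^ (a + 1)) = ((a + i).choose i : ℤ) := by
  rw [mk_one_pow_eq_mk_choose_add, coeff_mk, Nat.choose_symm_add]

open PowerSeries in
theorem su2_T (M a : ℕ) : ∑ i ∈ Finset.range (M + 1),
      (zChoose ((2 * M + a : ℕ) : ℤ) (i : ℤ) - zChoose ((2 * M + a : ℕ) : ℤ) ((i : ℤ) - 1)) *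
        ((a + (M - i)).choose (M - i) : ℤ) =
      coeff M ((1 + X : ℤ⟦X⟧) ^ (2 * M + a) * (mk 1) ^ a) := by
  have hQ := su2_Q_mul
  have : (1 + X : ℤ⟦X⟧) ^ (2 * M + a) * (mk 1) ^ a =
      ((1 - X) * (1 + X : ℤ⟦X⟧) ^ (2 * M + a)) * (mk 1) ^ (a + 1) := by
    generalize (mk 1 : ℤ⟦X⟧) = Q at *
    linear_combination (-(1 + X : ℤ⟦X⟧) ^ (2 * M + a) * Q ^ a) * hQ
  rw [this, coeff_mul, Finset.Nat.sum_antidiagonal_eq_sum_range_succ_mk]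
  apply Finset.sum_congr rfl
  intro i _
  simp only [su2_coeff_f, su2_coeff_Q]

open PowerSeries in
theorem su2_S (M a : ℕ) : ∑ i ∈ Finset.range (M + 1 + 1),
      (zChoose ((2 * (M + 1) + a : ℕ) : ℤ) (i : ℤ)
        - zChoose ((2 * (M + 1) + a : ℕ) : ℤ) ((i : ℤ) - 1)) *
        ((-1) ^ i * ((a + (M + 1 - i)).choose (M + 1 - i) : ℤ)) = 0 := by
  have h0 : coeff (M + 1) (((1 + X) * (1 - X : ℤ⟦X⟧) ^ (2 * (M + 1) + a)) * (mk 1) ^ (a + 1))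
      = 0 := by
    have hQ := su2_Q_mul
    have e : 2 * (M + 1) + a = (2 * M + 1) + (a + 1) := by ring
    have hp : ((1 + X) * (1 - X : ℤ⟦X⟧) ^ (2 * (M + 1) + a)) * (mk 1) ^ (a + 1) =
        (1 + X) * (1 - X : ℤ⟦X⟧) ^ (2 * M + 1) := by
      rw [e, pow_add, mul_assoc, mul_assoc, ← mul_pow, mul_comm (1 - X) (mk 1), hQ, one_pow,
        mul_one]
    rw [hp, su2_coeff_f_neg, su2_zChoose_nat]
    have : (((M + 1 : ℕ) : ℤ) - 1) = (M : ℤ) := by push_cast; ring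
    rw [this, su2_zChoose_nat, Nat.choose_symm_half]
    simp
  rw [← h0, coeff_mul, Finset.Nat.sum_antidiagonal_eq_sum_range_succ_mk]
  apply Finset.sum_congr rfl
  intro i _
  simp only [su2_coeff_f_neg, su2_coeff_Q]
  ring

/-- Lemma (SU2_nontrivial_existence): if `t ≥ c(n,k)` the SU(2) system has the explicit
nontrivial integer solution `y_j = (−1)^j C(n−⌊k/2⌋−1−j, ⌊k/2⌋+1−j)`. -/
theorem SU2_nontrivial_existence (n k t : ℕ) (hk : 2 ≤ k)
    (hn : 2 * (k / 2 + 1) ≤ n) (ht : 0 < t) (htc : su2C n k ≤ (t : ℚ)) :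
    SU2Nontrivial n (fun j : ℕ => (-1) ^ j *
        zChoose ((n : ℤ) - ((k / 2 : ℕ) : ℤ) - 1 - (j : ℤ))
          (((k / 2 : ℕ) : ℤ) + 1 - (j : ℤ))) ∧
    SU2System n k t (fun j : ℕ => (-1) ^ j *
        zChoose ((n : ℤ) - ((k / 2 : ℕ) : ℤ) - 1 - (j : ℤ))
          (((k / 2 : ℕ) : ℤ) + 1 - (j : ℤ))) := by
  unfold su2C at htc
  unfold SU2System SU2Nontrivial
  generalize k / 2 = q at *
  clear hk
  obtain ⟨a, rfl⟩ := Nat.exists_eq_add_of_le hn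
  obtain ⟨r, hr⟩ : ∃ r, (2 * (q + 1) + a) / 2 + 1 = (q + 1 + 1) + r :=
    ⟨(2 * (q + 1) + a) / 2 + 1 - (q + 1 + 1), by omega⟩
  have hy : ∀ j : ℕ, j < q + 1 + 1 →
      zChoose (((2 * (q + 1) + a : ℕ) : ℤ) - (q : ℤ) - 1 - (j : ℤ)) ((q : ℤ) + 1 - (j : ℤ)) =
        ((a + (q + 1 - j)).choose (q + 1 - j) : ℤ) := by
    intro j hj
    rw [← su2_zChoose_nat]
    congr 1 <;> omega
  have hy0 : ∀ j : ℕ,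
      zChoose (((2 * (q + 1) + a : ℕ) : ℤ) - (q : ℤ) - 1 - ((q + 1 + 1 + j : ℕ) : ℤ))
        ((q : ℤ) + 1 - ((q + 1 + 1 + j : ℕ) : ℤ)) = 0 := by
    intro j
    exact su2_zChoose_neg _ _ (by omega)
  rw [hr]
  refine ⟨⟨q + 1, by simp; omega, ?_⟩, ?_, ?_⟩
  · simp only [hy (q + 1) (by omega)]
    simp
  · rw [Finset.sum_range_add]
    have hz : ∑ x ∈ Finset.range r,
      (zChoose ((2 * (q + 1) + a : ℕ) : ℤ) ((q + 1 + 1 + x : ℕ) : ℤ) -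
        zChoose ((2 * (q + 1) + a : ℕ) : ℤ) (((q + 1 + 1 + x : ℕ) : ℤ) - 1)) *
      |(-1) ^ (q + 1 + 1 + x) *
        zChoose (((2 * (q + 1) + a : ℕ) : ℤ) - (q : ℤ) - 1 - ((q + 1 + 1 + x : ℕ) : ℤ))
          ((q : ℤ) + 1 - ((q + 1 + 1 + x : ℕ) : ℤ))| = 0 := by
      apply Finset.sum_eq_zero
      intro x _
      rw [hy0]; simp
    rw [hz, add_zero]
    have hs := su2_T (q + 1) a
    have hc := su2_G_closed (q + 1) a
    rw [← hs] at hc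
    have he : ∀ j ∈ Finset.range (q + 1 + 1),
      (zChoose ((2 * (q + 1) + a : ℕ) : ℤ) (j : ℤ) -
        zChoose ((2 * (q + 1) + a : ℕ) : ℤ) ((j : ℤ) - 1)) *
      |(-1) ^ j *
        zChoose (((2 * (q + 1) + a : ℕ) : ℤ) - (q : ℤ) - 1 - (j : ℤ)) ((q : ℤ) + 1 - (j : ℤ))| =
      (zChoose ((2 * (q + 1) + a : ℕ) : ℤ) (j : ℤ) -
        zChoose ((2 * (q + 1) + a : ℕ) : ℤ) ((j : ℤ) - 1)) *
        ((a + (q + 1 - j)).choose (q + 1 - j) : ℤ) := by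
      intro j hj
      rw [hy j (Finset.mem_range.1 hj), abs_mul, abs_pow]
      simp
    rw [Finset.sum_congr rfl he]
    generalize (∑ i ∈ Finset.range (q + 1 + 1), _ : ℤ) = T at hc ⊢
    have hprod : ∏ α ∈ Finset.Icc 1 (q + 1),
        (((2 * (q + 1) + a : ℕ) : ℚ) - 2 * (α : ℚ) + 1) =
        ((∏ i ∈ Finset.range (q + 1), ((a : ℤ) + 1 + 2 * i) : ℤ) : ℚ) := by
      rw [← Finset.prod_range_reflect, Finset.range_eq_Ico]
      push_cast
      rw [show Finset.Icc 1 (q + 1) = Finset.Ico (0 + 1) (q + 1 + 1) from by ext; simp,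
        ← Finset.prod_Ico_add']
      apply Finset.prod_congr rfl
      intro i hi
      have hi' : i ≤ q := by have := (Finset.mem_Ico.1 hi).2; omega
      rw [Nat.cast_sub hi']
      push_cast; ring
    rw [hprod] at htc
    generalize (∏ i ∈ Finset.range (q + 1), ((a : ℤ) + 1 + 2 * i) : ℤ) = P at hc htc
    have hc' : ((q + 1).factorial : ℚ) * (T : ℚ) = 2 ^ (q + 1) * (P : ℚ) := by
      exact_mod_cast hc
    have hf : ((q + 1).factorial : ℚ) ≠ 0 := by exact_mod_cast Nat.factorial_ne_zero _
    have hT : (T : ℚ) = 2 * (2 ^ q / ((q + 1).factorial : ℚ) * (P : ℚ)) := by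
      field_simp
      rw [pow_succ] at hc'
      linear_combination hc'
    have : (T : ℚ) ≤ 2 * (t : ℚ) := by rw [hT]; linarith
    exact_mod_cast this
  · intro l hl
    obtain ⟨M, rfl⟩ : ∃ M, q = l + M :=
      ⟨q - l, by have := Finset.mem_range.1 hl; omega⟩
    rw [Finset.sum_range_add, show l + M + 1 + 1 = l + (M + 1 + 1) by ring,
      Finset.sum_range_add]
    have z1 : ∀ m : ℤ, ∀ f : ℕ → ℤ, ∑ x ∈ Finset.range l,
        (zChoose m ((x : ℤ) - (l : ℤ)) - zChoose m ((x : ℤ) - (l : ℤ) - 1)) * f x = 0 := by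
      intro m f
      apply Finset.sum_eq_zero
      intro x hx
      have := Finset.mem_range.1 hx
      rw [su2_zChoose_neg _ _ (by omega), su2_zChoose_neg _ _ (by omega)]; simp
    rw [z1 _ (fun x => _)]
    rw [Finset.sum_eq_zero (s := Finset.range r), zero_add, add_zero]
    · have hS := su2_S M a
      have hm : (-1 : ℤ) ^ l * 0 = 0 := by simp
      rw [← hm, ← hS, Finset.mul_sum]
      apply Finset.sum_congr rfl
      intro i hi
      have hi' := Finset.mem_range.1 hi
      beta_reduce
      rw [hy (l + i) (by omega)]
      rw [show ((2 * (l + M + 1) + a : ℕ) : ℤ) - 2 * (l : ℤ) = ((2 * (M + 1) + a : ℕ) : ℤ) by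
          push_cast; ring,
        show ((l + i : ℕ) : ℤ) - (l : ℤ) = (i : ℤ) by push_cast; ring,
        show l + M + 1 - (l + i) = M + 1 - i by omega]
      ring
    · intro x _
      have := hy0 x
      beta_reduce
      rw [show l + (M + 1 + 1) + x = l + M + 1 + 1 + x by ring, this]
      simp
end
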